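/- arXiv:1503.01149 — 3 statements merged into one kernel-verified Lean document; each statement's English description precedes it below -/
import Mathlib

section
/- Let K be an algebraically closed field of characteristic 0, let d ≥ 5, and let F ∈ K[X,Y,Z] be a nonsingular homogeneous polynomial of degree d. If Aut(F) contains an element of order ℓ(d−1) for some integer ℓ with 2 ≤ ℓ ≤ d−1, then Aut(F) is cyclic and contains a homology of period d−1, i.e. an element of order d−1 represented by a matrix that is conjugate in GL(3,K) to the diagonal matrix diag(1,1,ζ) for some primitive (d−1)-th root of unity ζ ∈ K. -/
open MvPolynomial Matrix

noncomputable section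

variable {K : Type*} [Field K]

/-- The substitution `F ∘ A`, i.e. `X i ↦ ∑ j, A i j • X j`. -/
def substPoly (A : Matrix (Fin 3) (Fin 3) K) (F : MvPolynomial (Fin 3) K) :
    MvPolynomial (Fin 3) K :=
  aeval (fun i => ∑ j, A i j • X j) F

lemma substPoly_one (F : MvPolynomial (Fin 3) K) : substPoly 1 F = F := by
  have h : (fun i => ∑ j, (1 : Matrix (Fin 3) (Fin 3) K) i j • X j)
      = (X : Fin 3 → MvPolynomial (Fin 3) K) := by
    funext i
    simp [Matrix.one_apply, ite_smul]
  rw [substPoly, h]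
  exact aeval_X_left_apply F

lemma substPoly_smul (A : Matrix (Fin 3) (Fin 3) K) (c : K) (F : MvPolynomial (Fin 3) K) :
    substPoly A (c • F) = c • substPoly A F := by
  unfold substPoly
  exact _root_.map_smul (aeval fun i => ∑ j, A i j • X j) c F

lemma substPoly_mul (A B : Matrix (Fin 3) (Fin 3) K) (F : MvPolynomial (Fin 3) K) :
    substPoly (A * B) F = substPoly B (substPoly A F) := by
  have hfun : (fun i => ∑ j, (A * B) i j • (X j : MvPolynomial (Fin 3) K))
      = fun i => (aeval fun i => (∑ j, B i j • X j : MvPolynomial (Fin 3) K))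
          (∑ j, A i j • X j : MvPolynomial (Fin 3) K) := by
    funext i
    rw [map_sum]
    simp only [_root_.map_smul, aeval_X, Matrix.mul_apply, Finset.sum_smul, Finset.smul_sum, smul_smul]
    exact Finset.sum_comm
  have h1 : substPoly (A * B) F
      = aeval (fun i => (aeval fun i => (∑ j, B i j • X j : MvPolynomial (Fin 3) K))
          (∑ j, A i j • X j : MvPolynomial (Fin 3) K)) F := by
    unfold substPoly
    exact congrArg
      (fun f => (aeval f : MvPolynomial (Fin 3) K →ₐ[K] MvPolynomial (Fin 3) K) F) hfun
  rw [h1, ← MvPolynomial.comp_aeval]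
  rfl

/-- The subgroup of `GL₃(K)` preserving the polynomial `F` up to scalar. -/
def autGL (F : MvPolynomial (Fin 3) K) : Subgroup (GL (Fin 3) K) where
  carrier := {A | ∃ c : Kˣ, substPoly (A : Matrix (Fin 3) (Fin 3) K) F = (c : K) • F}
  one_mem' := ⟨1, by simp [substPoly_one]⟩
  mul_mem' := by
    rintro A B ⟨c, hc⟩ ⟨e, he⟩
    refine ⟨c * e, ?_⟩
    have hAB : ((A * B : GL (Fin 3) K) : Matrix (Fin 3) (Fin 3) K)
        = (A : Matrix (Fin 3) (Fin 3) K) * (B : Matrix (Fin 3) (Fin 3) K) := rfl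
    rw [hAB, substPoly_mul, hc, substPoly_smul, he, smul_smul, ← Units.val_mul]
  inv_mem' := by
    rintro A ⟨c, hc⟩
    refine ⟨c⁻¹, ?_⟩
    have key : (c : K) • substPoly ((A⁻¹ : GL (Fin 3) K) : Matrix (Fin 3) (Fin 3) K) F = F := by
      rw [← substPoly_smul, ← hc, ← substPoly_mul]
      have h1 : (A : Matrix (Fin 3) (Fin 3) K) *
          ((A⁻¹ : GL (Fin 3) K) : Matrix (Fin 3) (Fin 3) K) = 1 := by
        exact_mod_cast Units.mul_inv A
      rw [h1, substPoly_one]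
    calc substPoly ((A⁻¹ : GL (Fin 3) K) : Matrix (Fin 3) (Fin 3) K) F
        = ((c : K)⁻¹ * (c : K)) •
            substPoly ((A⁻¹ : GL (Fin 3) K) : Matrix (Fin 3) (Fin 3) K) F := by
          rw [inv_mul_cancel₀ (Units.ne_zero c), one_smul]
      _ = (c : K)⁻¹ • ((c : K) •
            substPoly ((A⁻¹ : GL (Fin 3) K) : Matrix (Fin 3) (Fin 3) K) F) := by
          rw [smul_smul]
      _ = (c : K)⁻¹ • F := by rw [key]
      _ = ((c⁻¹ : Kˣ) : K) • F := by rw [Units.val_inv_eq_inv_val]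

/-- `PGL₃(K)`: the quotient of `GL₃(K)` by its center (the scalar matrices). -/
abbrev PGL3 (K : Type*) [Field K] := GL (Fin 3) K ⧸ Subgroup.center (GL (Fin 3) K)

/-- The automorphism group of the plane curve `F = 0`, as a subgroup of `PGL₃(K)`:
the classes of matrices `A` with `F ∘ A = λ • F` for some `λ ∈ Kˣ`. -/
def projAut (F : MvPolynomial (Fin 3) K) : Subgroup (PGL3 K) :=
  (autGL F).map (QuotientGroup.mk' (Subgroup.center (GL (Fin 3) K)))

/-- `F` is nonsingular: the only common zero of its partial derivatives is the origin. -/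
def IsNonsingular (F : MvPolynomial (Fin 3) K) : Prop :=
  ∀ x : Fin 3 → K, (∀ i, eval x (pderiv i F) = 0) → x = 0

/-- `F` and `G` are projectively equivalent: `F ∘ A = λ • G` for some `A ∈ GL₃(K)`, `λ ∈ Kˣ`. -/
def ProjEquiv (F G : MvPolynomial (Fin 3) K) : Prop :=
  ∃ A : GL (Fin 3) K, ∃ c : Kˣ,
    substPoly (A : Matrix (Fin 3) (Fin 3) K) F = (c : K) • G


/-! ### Basic facts on substitution -/

lemma substPoly_add (A : Matrix (Fin 3) (Fin 3) K) (F G : MvPolynomial (Fin 3) K) :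
    substPoly A (F + G) = substPoly A F + substPoly A G :=
  map_add (aeval (R := K) (fun i => ∑ j, A i j • (X j : MvPolynomial (Fin 3) K))) F G

lemma substPoly_mul_poly (A : Matrix (Fin 3) (Fin 3) K) (F G : MvPolynomial (Fin 3) K) :
    substPoly A (F * G) = substPoly A F * substPoly A G :=
  map_mul (aeval (R := K) (fun i => ∑ j, A i j • (X j : MvPolynomial (Fin 3) K))) F G

lemma substPoly_pow (A : Matrix (Fin 3) (Fin 3) K) (F : MvPolynomial (Fin 3) K) (n : ℕ) :
    substPoly A (F ^ n) = substPoly A F ^ n :=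
  map_pow (aeval (R := K) (fun i => ∑ j, A i j • (X j : MvPolynomial (Fin 3) K))) F n

lemma substPoly_X (A : Matrix (Fin 3) (Fin 3) K) (i : Fin 3) :
    substPoly A (X i) = ∑ j, A i j • (X j : MvPolynomial (Fin 3) K) :=
  aeval_X _ i

lemma substPoly_C (A : Matrix (Fin 3) (Fin 3) K) (a : K) :
    substPoly A (C a) = C a :=
  (aeval (R := K) (fun i => ∑ j, A i j • (X j : MvPolynomial (Fin 3) K))).commutes a

lemma substPoly_zero (A : Matrix (Fin 3) (Fin 3) K) :
    substPoly A (0 : MvPolynomial (Fin 3) K) = 0 :=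
  map_zero (aeval (R := K) (fun i => ∑ j, A i j • (X j : MvPolynomial (Fin 3) K)))

lemma substPoly_eval (A : Matrix (Fin 3) (Fin 3) K) (F : MvPolynomial (Fin 3) K)
    (v : Fin 3 → K) : eval v (substPoly A F) = eval (A *ᵥ v) F := by
  induction F using MvPolynomial.induction_on with
  | C a => simp [substPoly_C]
  | add p q hp hq => simp [hp, hq, substPoly_add]
  | mul_X p i hp =>
    rw [substPoly_mul_poly, map_mul, map_mul, hp, substPoly_X]
    simp [Matrix.mulVec, dotProduct, smul_eval]

lemma substPoly_isHomogeneous (A : Matrix (Fin 3) (Fin 3) K) {F : MvPolynomial (Fin 3) K}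
    {d : ℕ} (hF : F.IsHomogeneous d) : (substPoly A F).IsHomogeneous d := by
  have := hF.aeval (S := K) (n := 1) (fun i => ∑ j, A i j • (X j : MvPolynomial (Fin 3) K))
    (fun i => IsHomogeneous.sum _ _ _ fun j _ => by
      rw [MvPolynomial.smul_eq_C_mul]; exact (isHomogeneous_X K j).C_mul _)
  rw [one_mul] at this
  exact this

lemma substPoly_pderiv (A : Matrix (Fin 3) (Fin 3) K) (F : MvPolynomial (Fin 3) K) (j : Fin 3) :
    pderiv j (substPoly A F) = ∑ k, A k j • substPoly A (pderiv k F) := by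
  induction F using MvPolynomial.induction_on with
  | C a => simp [substPoly_C, substPoly_zero]
  | add p q hp hq => simp [hp, hq, Finset.sum_add_distrib, substPoly_add]
  | mul_X p i hp =>
    have h1 : ∀ k, pderiv k (p * X i : MvPolynomial (Fin 3) K)
        = p * C (if k = i then 1 else 0) + X i * pderiv k p := by
      intro k
      rw [Derivation.leibniz, pderiv_X]
      by_cases h : k = i
      · subst h; simp
      · simp [h]
    have h2 : pderiv j (substPoly A (X i)) = C (A i j) := by
      rw [substPoly_X, map_sum]
      simp [pderiv_X, Pi.single_apply, MvPolynomial.smul_eq_C_mul]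
    rw [substPoly_mul_poly, Derivation.leibniz, h2, hp]
    simp only [h1, substPoly_add, substPoly_mul_poly, substPoly_C, smul_add,
      Finset.sum_add_distrib, smul_eq_mul, Finset.mul_sum, mul_smul_comm]
    congr 1
    simp [MvPolynomial.smul_eq_C_mul, mul_comm, apply_ite C]

lemma eval_pderiv_substPoly (A : Matrix (Fin 3) (Fin 3) K) (F : MvPolynomial (Fin 3) K)
    (j : Fin 3) (v : Fin 3 → K) :
    eval v (pderiv j (substPoly A F)) = ∑ k, A k j * eval (A *ᵥ v) (pderiv k F) := by
  rw [substPoly_pderiv, map_sum]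
  simp [smul_eval, substPoly_eval]

lemma GL_mul_inv' (A : GL (Fin 3) K) :
    (A : Matrix (Fin 3) (Fin 3) K) * ((A⁻¹ : GL (Fin 3) K) : Matrix (Fin 3) (Fin 3) K) = 1 := by
  exact_mod_cast Units.mul_inv A

lemma GL_inv_mul' (A : GL (Fin 3) K) :
    ((A⁻¹ : GL (Fin 3) K) : Matrix (Fin 3) (Fin 3) K) * (A : Matrix (Fin 3) (Fin 3) K) = 1 := by
  exact_mod_cast Units.inv_mul A

lemma isNonsingular_subst (A : GL (Fin 3) K) {F : MvPolynomial (Fin 3) K}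
    (hF : IsNonsingular F) : IsNonsingular (substPoly (A : Matrix (Fin 3) (Fin 3) K) F) := by
  intro v hv
  set w := (A : Matrix (Fin 3) (Fin 3) K) *ᵥ v with hw
  set u : Fin 3 → K := fun k => eval w (pderiv k F) with hu
  have h1 : u ᵥ* (A : Matrix (Fin 3) (Fin 3) K) = 0 := by
    funext j
    have := hv j
    rw [eval_pderiv_substPoly] at this
    simp only [Matrix.vecMul, dotProduct, Pi.zero_apply]
    rw [← this]
    exact Finset.sum_congr rfl fun k _ => mul_comm _ _
  have h2 : u = 0 := by
    have := congrArg (fun y => y ᵥ* ((A⁻¹ : GL (Fin 3) K) : Matrix (Fin 3) (Fin 3) K)) h1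
    simpa [Matrix.vecMul_vecMul, GL_mul_inv'] using this
  have h3 : w = 0 := hF w fun i => congrFun h2 i
  have := congrArg (fun y => ((A⁻¹ : GL (Fin 3) K) : Matrix (Fin 3) (Fin 3) K) *ᵥ y) (hw.symm.trans h3)
  simpa [Matrix.mulVec_mulVec, GL_inv_mul'] using this

lemma eval_smul_of_isHomogeneous {F : MvPolynomial (Fin 3) K} {d : ℕ} (hF : F.IsHomogeneous d)
    (c : K) (v : Fin 3 → K) : eval (c • v) F = c ^ d * eval v F := by
  rw [eval_eq, eval_eq, Finset.mul_sum]
  refine Finset.sum_congr rfl fun m hm => ?_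
  have hdeg := hF.degree_eq_sum_deg_support hm
  simp only [Pi.smul_apply, smul_eq_mul, mul_pow, Finset.prod_mul_distrib]
  rw [Finset.prod_pow_eq_pow_sum, ← hdeg]
  ring

/-- A homogeneous polynomial of positive degree has a nontrivial zero on each line. -/
lemma exists_zero_on_line [IsAlgClosed K] [CharZero K] {H : MvPolynomial (Fin 3) K} {m : ℕ}
    (hH : H.IsHomogeneous m) (hm : m ≠ 0) (u v : Fin 3 → K) :
    ∃ s t : K, (s ≠ 0 ∨ t ≠ 0) ∧ eval (s • u + t • v) H = 0 := by
  by_contra hcon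
  push Not at hcon
  -- the polynomial `H (u + T v)`
  have hpoly : ∀ a b : Fin 3 → K, ∃ p : Polynomial K, ∀ t, p.eval t = eval (a + t • b) H := by
    intro a b
    refine ⟨eval₂ Polynomial.C
      (fun i => Polynomial.C (a i) + Polynomial.X * Polynomial.C (b i)) H, fun t => ?_⟩
    rw [← Polynomial.coe_evalRingHom, MvPolynomial.hom_eval₂]
    have : (Polynomial.evalRingHom t).comp Polynomial.C = RingHom.id K := by
      ext x; simp
    rw [this]
    simp only [MvPolynomial.eval, coe_eval₂Hom]
    congr 1
    funext i
    simp
    ring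
  obtain ⟨p, hp⟩ := hpoly u v
  obtain ⟨q, hq⟩ := hpoly v u
  have hroot : p.degree = 0 := by
    by_contra h0
    obtain ⟨t, ht⟩ := IsAlgClosed.exists_root p h0
    refine hcon 1 t (Or.inl one_ne_zero) ?_
    rw [one_smul, ← hp, ht]
  rw [Polynomial.eq_C_of_degree_eq_zero hroot] at hp
  have hpc : ∀ t : K, eval (u + t • v) H = p.coeff 0 := fun t => by rw [← hp]; simp
  have hqe : q = Polynomial.C (p.coeff 0) * Polynomial.X ^ m := by
    refine Polynomial.eq_of_infinite_eval_eq _ _ (Set.Infinite.mono (s := {x | x ≠ 0}) ?_ ?_)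
    · intro s hs
      have hs' : s ≠ 0 := hs
      have : v + s • u = s • (u + s⁻¹ • v) := by
        rw [smul_add, smul_smul, mul_inv_cancel₀ hs', one_smul, add_comm]
      change q.eval s = _
      rw [hq, this, eval_smul_of_isHomogeneous hH, hpc, Polynomial.eval_mul, Polynomial.eval_C,
        Polynomial.eval_pow, Polynomial.eval_X, mul_comm]
    · exact (Set.finite_singleton (0 : K)).infinite_compl
  refine hcon 0 1 (Or.inr one_ne_zero) ?_
  have := hq 0
  rw [hqe] at this
  simpa [hm] using this.symm

/-! ### The automorphisms of a curve in normal form -/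

lemma substPoly_prime (A : GL (Fin 3) K) {F : MvPolynomial (Fin 3) K} (hF : Prime F) :
    Prime (substPoly (A : Matrix (Fin 3) (Fin 3) K) F) := by
  let φ : MvPolynomial (Fin 3) K ≃* MvPolynomial (Fin 3) K :=
    { toFun := substPoly (A : Matrix (Fin 3) (Fin 3) K)
      invFun := substPoly ((A⁻¹ : GL (Fin 3) K) : Matrix (Fin 3) (Fin 3) K)
      left_inv := fun G => by rw [← substPoly_mul, GL_mul_inv', substPoly_one]
      right_inv := fun G => by rw [← substPoly_mul, GL_inv_mul', substPoly_one]
      map_mul' := fun G H => substPoly_mul_poly _ G H }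
  exact (MulEquiv.prime_iff φ).2 hF

lemma pderiv_comm (i j : Fin 3) (F : MvPolynomial (Fin 3) K) :
    pderiv i (pderiv j F) = pderiv j (pderiv i F) := by
  ext m
  simp only [coeff_pderiv]
  rw [add_right_comm]
  by_cases h : i = j
  · subst h; rfl
  · simp [h, Ne.symm h]
    ring

/-- the key step: the center of the homology is fixed and its axis is preserved. -/
lemma row_of_aut {e : ℕ} {F : MvPolynomial (Fin 3) K} [CharZero K]
    (hhom : F.IsHomogeneous (e + 5)) {β : K} (hβ : β ≠ 0)
    (hN : pderiv 2 F = C β * (X 2 ^ (e + 3) * X 1))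
    (hN0 : eval (Pi.single 0 1) F ≠ 0)
    (A : GL (Fin 3) K) {c : K}
    (hA : substPoly (A : Matrix (Fin 3) (Fin 3) K) F = c • F) :
    ∃ r : K, r ≠ 0 ∧ substPoly (A : Matrix (Fin 3) (Fin 3) K) (X 2) = C r * X 2 := by
  set M : Matrix (Fin 3) (Fin 3) K := (A : Matrix (Fin 3) (Fin 3) K) with hM
  set M' : Matrix (Fin 3) (Fin 3) K := ((A⁻¹ : GL (Fin 3) K) : Matrix (Fin 3) (Fin 3) K) with hM'
  have hMM' : M * M' = 1 := GL_mul_inv' A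
  have hM'M : M' * M = 1 := GL_inv_mul' A
  set L := substPoly M' (X 2 : MvPolynomial (Fin 3) K) with hL
  have hLp : Prime L := substPoly_prime A⁻¹ (X_prime (R := K))
  have hLh : L.IsHomogeneous 1 := substPoly_isHomogeneous _ (isHomogeneous_X K 2)
  have hLd : L.totalDegree = 1 := hLh.totalDegree hLp.ne_zero
  by_cases hdvd : L ∣ X 2
  · obtain ⟨q, hq⟩ := hdvd
    have hq0 : q ≠ 0 := by
      rintro rfl
      rw [mul_zero] at hq
      exact X_ne_zero _ hq
    have hdeg := totalDegree_mul_of_isDomain hLp.ne_zero hq0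
    rw [← hq, totalDegree_X, hLd] at hdeg
    have hqd : q.totalDegree = 0 := by omega
    rw [totalDegree_eq_zero_iff_eq_C] at hqd
    set r := coeff 0 q with hr
    have hr0 : r ≠ 0 := by
      intro h
      rw [h, C_0] at hqd
      exact hq0 hqd
    refine ⟨r, hr0, ?_⟩
    have h1 := congrArg (substPoly M) hq
    rwa [substPoly_mul_poly, hL, ← substPoly_mul, hM'M, substPoly_one, hqd, substPoly_C,
      mul_comm] at h1
  · exfalso
    -- `D_w F = c β L ^ (e+3) * M`
    have h1 : ∑ k, M k 2 • pderiv k F = C (c * β) * (L ^ (e + 3) * substPoly M' (X 1)) := by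
      have h2 := substPoly_pderiv M F 2
      rw [hA, Derivation.map_smul, hN] at h2
      have h3 := congrArg (substPoly M') h2
      rw [substPoly_smul, substPoly_mul_poly, substPoly_mul_poly, substPoly_pow, substPoly_C] at h3
      simp only [Fin.sum_univ_three, substPoly_add, substPoly_smul, ← substPoly_mul, hMM',
        substPoly_one] at h3
      rw [Fin.sum_univ_three, ← h3, MvPolynomial.smul_eq_C_mul, C_mul, mul_assoc]
    have h2 : pderiv 2 (∑ k, M k 2 • pderiv k F)
        = X 2 ^ (e + 2) * (C β * (C ((e + 3 : ℕ) * M 2 2) * X 1 + C (M 1 2) * X 2)) := by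
      simp only [Fin.sum_univ_three, map_add, Derivation.map_smul, pderiv_comm 2, hN]
      simp only [Derivation.leibniz, Derivation.leibniz_pow, pderiv_X,
        MvPolynomial.smul_eq_C_mul, smul_eq_mul, nsmul_eq_mul, C_mul]
      simp
      rw [show (C 3 : MvPolynomial (Fin 3) K) = 3 from map_ofNat C 3]
      ring
    have h3 : L ^ (e + 2) ∣ pderiv 2 (∑ k, M k 2 • pderiv k F) := by
      rw [h1]
      rw [pderiv_C_mul]
      simp only [Derivation.leibniz, Derivation.leibniz_pow, smul_eq_mul, nsmul_eq_mul]
      refine Dvd.dvd.mul_left (dvd_add ?_ ?_) _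
      · exact Dvd.dvd.mul_right (pow_dvd_pow _ (by omega)) _
      · exact ⟨substPoly M' (X 1) * ((e + 3 : ℕ) * pderiv 2 L), by
          simp only [show e + 3 - 1 = e + 2 from rfl]; ring⟩
    rw [h2] at h3
    have h4 := hLp.pow_dvd_of_dvd_mul_left (e + 2)
      (fun h => hdvd (hLp.dvd_of_dvd_pow h)) h3
    set N : MvPolynomial (Fin 3) K :=
      C β * (C ((e + 3 : ℕ) * M 2 2) * X 1 + C (M 1 2) * X 2) with hNdef
    have hNh : N.IsHomogeneous 1 :=
      (((isHomogeneous_X K 1).C_mul _).add ((isHomogeneous_X K 2).C_mul _)).C_mul _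
    have hN0' : N = 0 := by
      by_contra hne
      obtain ⟨q, hq⟩ := h4
      have hq0 : q ≠ 0 := by
        rintro rfl
        exact hne (by rw [hq, mul_zero])
      have h5 := totalDegree_mul_of_isDomain (pow_ne_zero (e + 2) hLp.ne_zero) hq0
      rw [← hq, hNh.totalDegree hne,
        (hLh.pow (e + 2)).totalDegree (pow_ne_zero _ hLp.ne_zero)] at h5
      omega
    have h22 : M 2 2 = 0 := by
      have := congrArg (eval (Pi.single 1 1 : Fin 3 → K)) hN0'
      simp [hNdef, hβ] at this
      rcases this with h | h
      · exact absurd h (by norm_cast)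
      · exact h
    have h12 : M 1 2 = 0 := by
      have := congrArg (eval (Pi.single 2 1 : Fin 3 → K)) hN0'
      simpa [hNdef, hβ] using this
    have hcol : M *ᵥ (Pi.single 2 1) = M 0 2 • (Pi.single 0 1 : Fin 3 → K) := by
      funext i
      rw [Matrix.mulVec_single_one]
      fin_cases i <;> simp [h22, h12]
    have h02 : M 0 2 ≠ 0 := by
      intro h
      rw [h, zero_smul] at hcol
      have := congrArg (fun y => M' *ᵥ y) hcol
      simp only [Matrix.mulVec_mulVec, hM'M, Matrix.one_mulVec, Matrix.mulVec_zero] at this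
      simpa using congrFun this 2
    have hF2 : eval (Pi.single 2 1) F = 0 := by
      have h := congrArg (eval (Pi.single 2 1 : Fin 3 → K)) hhom.sum_X_mul_pderiv
      rw [Fin.sum_univ_three, hN] at h
      simp at h
      rcases h with h | h
      · exact absurd h (by norm_cast)
      · exact h
    have h6 := substPoly_eval M F (Pi.single 2 1)
    rw [hA, hcol, eval_smul_of_isHomogeneous hhom, smul_eval, hF2, mul_zero] at h6
    exact mul_ne_zero (pow_ne_zero _ h02) hN0 h6.symm

/-- Every automorphism of a curve in normal form is diagonal, with explicit relations. -/
lemma diag_of_aut [IsAlgClosed K] [CharZero K] {e : ℕ} {F : MvPolynomial (Fin 3) K}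
    (hhom : F.IsHomogeneous (e + 5)) (hns : IsNonsingular F) {β : K} (hβ : β ≠ 0)
    (hN : pderiv 2 F = C β * (X 2 ^ (e + 3) * X 1))
    (hN3 : eval (Pi.single 0 1) (pderiv 1 F) = 0)
    (A : GL (Fin 3) K) {c : K}
    (hA : substPoly (A : Matrix (Fin 3) (Fin 3) K) F = c • F) :
    ∃ a b r : K, (A : Matrix (Fin 3) (Fin 3) K) = Matrix.diagonal ![a, b, r] ∧
      a ^ (e + 5) = c ∧ r ^ (e + 4) * b = c ∧ (b ^ (e + 4) * a = c ∨ b ^ (e + 5) = c) := by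
  have hns' : ∀ v : Fin 3 → K, eval v (pderiv 0 F) = 0 → eval v (pderiv 1 F) = 0 →
      eval v (pderiv 2 F) = 0 → v = 0 := by
    intro v h0 h1 h2
    refine hns v (Fin.forall_fin_succ.2 ⟨h0, Fin.forall_fin_succ.2 ⟨h1, ?_⟩⟩)
    exact Fin.forall_fin_succ.2 ⟨h2, fun i => i.elim0⟩
  -- values at the coordinate points
  have hd0 : eval (Pi.single 0 1) (pderiv 2 F) = 0 := by rw [hN]; simp
  have hp0 : eval (Pi.single 0 1) (pderiv 0 F) ≠ 0 := by
    intro h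
    have := hns' (Pi.single 0 1) h hN3 hd0
    simpa using congrFun this 0
  have hF0 : eval (Pi.single 0 1) F ≠ 0 := by
    intro h0
    have h := congrArg (eval (Pi.single 0 1 : Fin 3 → K)) hhom.sum_X_mul_pderiv
    rw [Fin.sum_univ_three] at h
    simp [h0] at h
    exact hp0 h
  obtain ⟨r, hr0, hrow⟩ := row_of_aut hhom hβ hN hF0 A hA
  set M : Matrix (Fin 3) (Fin 3) K := (A : Matrix (Fin 3) (Fin 3) K) with hM
  set M' : Matrix (Fin 3) (Fin 3) K := ((A⁻¹ : GL (Fin 3) K) : Matrix (Fin 3) (Fin 3) K) with hM'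
  have hMM' : M * M' = 1 := GL_mul_inv' A
  have hM2 : ∀ v : Fin 3 → K, (M *ᵥ v) 2 = r * v 2 := by
    intro v
    have h := congrArg (eval v) hrow
    rw [substPoly_eval] at h
    simpa using h
  have h20 : M 2 0 = 0 := by simpa using hM2 (Pi.single 0 1)
  have h21 : M 2 1 = 0 := by simpa using hM2 (Pi.single 1 1)
  have h22 : M 2 2 = r := by simpa using hM2 (Pi.single 2 1)
  have hchain : ∀ j v, c * eval v (pderiv j F) = ∑ k, M k j * eval (M *ᵥ v) (pderiv k F) := by
    intro j v
    rw [← eval_pderiv_substPoly, hA, Derivation.map_smul, smul_eval]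
  -- on the axis
  have haxis : ∀ v : Fin 3 → K, v 2 = 0 → eval v (pderiv 2 F) = 0 := by
    intro v hv
    rw [hN]; simp [hv]
  have haxis' : ∀ v : Fin 3 → K, v 2 = 0 →
      M 0 2 * eval v (pderiv 0 F) + M 1 2 * eval v (pderiv 1 F) = 0 := by
    intro v hv
    have hv' : M *ᵥ (M' *ᵥ v) = v := by rw [Matrix.mulVec_mulVec, hMM', Matrix.one_mulVec]
    have hu : (M' *ᵥ v) 2 = 0 := by
      have := hM2 (M' *ᵥ v)
      rw [hv', hv] at this
      exact (mul_eq_zero.1 this.symm).resolve_left hr0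
    have := hchain 2 (M' *ᵥ v)
    rw [haxis _ hu, hv', Fin.sum_univ_three, haxis v hv] at this
    simpa using this.symm
  have hzero : ∀ j, ∃ v : Fin 3 → K, v ≠ 0 ∧ v 2 = 0 ∧ eval v (pderiv j F) = 0 := by
    intro j
    obtain ⟨s, t, hst, h⟩ := exists_zero_on_line (hhom.pderiv (i := j)) (by omega)
      (Pi.single 0 1) (Pi.single 1 1)
    refine ⟨_, ?_, ?_, h⟩
    · intro h0
      rcases hst with hs | ht
      · exact hs (by simpa using congrFun h0 0)
      · exact ht (by simpa using congrFun h0 1)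
    · simp
  have h02 : M 0 2 = 0 := by
    by_contra h
    obtain ⟨v, hv0, hv2, hv⟩ := hzero 1
    have h1 := haxis' v hv2
    rw [hv, mul_zero, add_zero] at h1
    have h2 := (mul_eq_zero.1 h1).resolve_left h
    have h3 := haxis v hv2
    exact hv0 (hns' v h2 hv h3)
  have h12 : M 1 2 = 0 := by
    by_contra h
    obtain ⟨v, hv0, hv2, hv⟩ := hzero 0
    have h1 := haxis' v hv2
    rw [hv, mul_zero, zero_add] at h1
    have h2 := (mul_eq_zero.1 h1).resolve_left h
    have h3 := haxis v hv2
    exact hv0 (hns' v hv h2 h3)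
  -- the second row
  have hY : ∀ v : Fin 3 → K,
      c * (v 2 ^ (e + 3) * v 1) = r * ((r * v 2) ^ (e + 3) * (M *ᵥ v) 1) := by
    intro v
    have h := hchain 2 v
    rw [Fin.sum_univ_three, h02, h12, h22, hN, zero_mul, zero_mul, zero_add, zero_add] at h
    simp only [map_mul, map_pow, eval_C, eval_X] at h
    rw [hM2] at h
    apply mul_left_cancel₀ hβ
    linear_combination h
  have h10 : M 1 0 = 0 := by
    have h := hY (Pi.single 0 1 + Pi.single 2 1)
    rw [Matrix.mulVec_add] at h
    simpa [hr0, h12] using h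
  have h11 : r ^ (e + 4) * M 1 1 = c := by
    have h := hY (Pi.single 1 1 + Pi.single 2 1)
    rw [Matrix.mulVec_add] at h
    simp [h12] at h
    rw [h]; ring
  have hcol0 : M *ᵥ (Pi.single 0 1) = M 0 0 • (Pi.single 0 1 : Fin 3 → K) := by
    funext i
    rw [Matrix.mulVec_single_one]
    fin_cases i <;> simp [h10, h20]
  have h00 : M 0 0 ^ (e + 5) = c := by
    have h6 := substPoly_eval M F (Pi.single 0 1)
    rw [hA, hcol0, eval_smul_of_isHomogeneous hhom, smul_eval] at h6
    exact (mul_right_cancel₀ hF0 h6).symm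
  have hM00 : M 0 0 ≠ 0 := by
    intro h
    rw [h, zero_smul] at hcol0
    have := congrArg (fun y => M' *ᵥ y) hcol0
    simp only [Matrix.mulVec_mulVec, show M' * M = 1 from GL_inv_mul' A, Matrix.one_mulVec,
      Matrix.mulVec_zero] at this
    simpa using congrFun this 0
  have h01 : M 0 1 = 0 := by
    have h := hchain 1 (Pi.single 0 1)
    rw [Fin.sum_univ_three, hcol0, eval_smul_of_isHomogeneous hhom.pderiv,
      eval_smul_of_isHomogeneous hhom.pderiv, h21, hN3] at h
    simpa [hM00, hp0] using h
  have hcol1 : M *ᵥ (Pi.single 1 1) = M 1 1 • (Pi.single 1 1 : Fin 3 → K) := by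
    funext i
    rw [Matrix.mulVec_single_one]
    fin_cases i <;> simp [h01, h21]
  refine ⟨M 0 0, M 1 1, r, ?_, h00, h11, ?_⟩
  · ext i j
    fin_cases i <;> fin_cases j <;> simp [h01, h02, h10, h12, h20, h21, h22]
  · have hd1 : eval (Pi.single 1 1) (pderiv 2 F) = 0 := haxis _ (by simp)
    by_cases hq0 : eval (Pi.single 1 1) (pderiv 0 F) = 0
    · by_cases hq1 : eval (Pi.single 1 1) (pderiv 1 F) = 0
      · have := hns' _ hq0 hq1 hd1
        simpa using congrFun this 1
      · right
        have h := hchain 1 (Pi.single 1 1)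
        rw [Fin.sum_univ_three, hcol1, eval_smul_of_isHomogeneous (hhom.pderiv (i := 1)),
          h21, h01] at h
        apply mul_right_cancel₀ hq1
        simp at h
        rw [h]; ring
    · left
      have h := hchain 0 (Pi.single 1 1)
      rw [Fin.sum_univ_three, hcol1, eval_smul_of_isHomogeneous (hhom.pderiv (i := 0)),
          h20, h10] at h
      apply mul_right_cancel₀ hq0
      simp at h
      rw [h]; ring

/-! ### The conclusion for curves in normal form -/

/-- The conclusion of the main theorem. -/
def Concl (d : ℕ) (F : MvPolynomial (Fin 3) K) : Prop :=
  IsCyclic ↥(projAut F) ∧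
    ∃ g ∈ projAut F, orderOf g = d - 1 ∧
      ∃ A : GL (Fin 3) K,
        QuotientGroup.mk' (Subgroup.center (GL (Fin 3) K)) A = g ∧
        ∃ ζ : K, IsPrimitiveRoot ζ (d - 1) ∧
          ∃ P : GL (Fin 3) K,
            ((P * A * P⁻¹ : GL (Fin 3) K) : Matrix (Fin 3) (Fin 3) K)
              = Matrix.diagonal ![1, 1, ζ]

lemma mem_center_GL {A : GL (Fin 3) K} :
    A ∈ Subgroup.center (GL (Fin 3) K) ↔
      ∃ u : K, (A : Matrix (Fin 3) (Fin 3) K) = Matrix.diagonal ![u, u, u] := by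
  rw [Matrix.GeneralLinearGroup.mem_center_iff_val_mem_range_scalar]
  have h : ∀ u : K, Matrix.scalar (Fin 3) u = Matrix.diagonal ![u, u, u] := by
    intro u
    ext i j
    fin_cases i <;> fin_cases j <;> simp
  simp only [Set.mem_range, h, eq_comm]

lemma center_le_autGL [Infinite K] {d : ℕ} {F : MvPolynomial (Fin 3) K}
    (hhom : F.IsHomogeneous d) : Subgroup.center (GL (Fin 3) K) ≤ autGL F := by
  intro A hA
  obtain ⟨u, hu⟩ := mem_center_GL.1 hA
  have hu0 : u ≠ 0 := by
    rintro rfl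
    have h := GL_mul_inv' A
    have h0 : (Matrix.diagonal ![0, 0, 0] : Matrix (Fin 3) (Fin 3) K) = 0 := by
      ext i j
      fin_cases i <;> fin_cases j <;> simp
    rw [hu, h0, zero_mul] at h
    exact zero_ne_one h
  refine ⟨Units.mk0 (u ^ d) (pow_ne_zero _ hu0), ?_⟩
  apply MvPolynomial.funext
  intro v
  have h1 : (Matrix.diagonal ![u, u, u]) *ᵥ v = u • v := by
    funext i
    rw [Matrix.mulVec_diagonal]
    fin_cases i <;> simp
  rw [substPoly_eval, hu, h1, eval_smul_of_isHomogeneous hhom, smul_eval, Units.val_mk0]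

/-- The one-parameter group `t ↦ diag (t ^ n, 1, t ^ (n + 1))`. -/
def torus (K : Type*) [Field K] (n : ℕ) : Kˣ →* GL (Fin 3) K :=
  MonoidHom.toHomUnits
    { toFun := fun t => Matrix.diagonal ![(t : K) ^ n, 1, (t : K) ^ (n + 1)]
      map_one' := by
        ext i j
        fin_cases i <;> fin_cases j <;> simp
      map_mul' := fun s t => by
        rw [Matrix.diagonal_mul_diagonal]
        congr 1
        funext i
        fin_cases i <;> simp [mul_pow] }

lemma torus_val (n : ℕ) (t : Kˣ) : (torus K n t : Matrix (Fin 3) (Fin 3) K)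
    = Matrix.diagonal ![(t : K) ^ n, 1, (t : K) ^ (n + 1)] := rfl

lemma diag_vec_inj {a b c a' b' c' : K}
    (h : (Matrix.diagonal ![a, b, c] : Matrix (Fin 3) (Fin 3) K) = Matrix.diagonal ![a', b', c']) :
    a = a' ∧ b = b' ∧ c = c' := by
  have h' := Matrix.diagonal_injective h
  exact ⟨congrFun h' 0, congrFun h' 1, congrFun h' 2⟩

lemma torus_mk_injective (n : ℕ) : Function.Injective
    ((QuotientGroup.mk' (Subgroup.center (GL (Fin 3) K))).comp (torus K n)) := by
  rw [injective_iff_map_eq_one]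
  intro t ht
  rw [MonoidHom.comp_apply, QuotientGroup.mk'_apply, QuotientGroup.eq_one_iff,
    mem_center_GL] at ht
  obtain ⟨u, hu⟩ := ht
  rw [torus_val] at hu
  obtain ⟨h1, h2, h3⟩ := diag_vec_inj hu
  subst h2
  rw [pow_succ, h1, one_mul] at h3
  exact Units.ext h3

lemma concl_normal [IsAlgClosed K] [CharZero K] {e ℓ : ℕ} {F : MvPolynomial (Fin 3) K}
    (hhom : F.IsHomogeneous (e + 5)) (hns : IsNonsingular F) {β : K} (hβ : β ≠ 0)
    (hN : pderiv 2 F = C β * (X 2 ^ (e + 3) * X 1))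
    (hN3 : eval (Pi.single 0 1) (pderiv 1 F) = 0)
    (hℓ : ℓ ≠ 0) (t : Kˣ) (ht : torus K (e + 4) t ∈ autGL F)
    (hord : orderOf t = ℓ * (e + 4)) : Concl (e + 5) F := by
  set ψ := (QuotientGroup.mk' (Subgroup.center (GL (Fin 3) K))).comp (torus K (e + 4)) with hψ
  set T := (autGL F).comap (torus K (e + 4)) with hT
  have hproj : projAut F = T.map ψ := by
    apply le_antisymm
    · rintro _ ⟨A, ⟨c, hA⟩, rfl⟩
      obtain ⟨a, b, r, hAd, h1, h2, -⟩ := diag_of_aut hhom hns hβ hN hN3 A hA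
      have hc := c.ne_zero
      have hb : b ≠ 0 := by rintro rfl; exact hc (by rw [← h2, mul_zero])
      have ha : a ≠ 0 := by rintro rfl; exact hc (by rw [← h1, zero_pow (by omega)])
      have hr : r ≠ 0 := by
        rintro rfl; exact hc (by rw [← h2, zero_pow (by omega), zero_mul])
      set s : Kˣ := Units.mk0 (r / a) (div_ne_zero hr ha) with hs
      have hs1 : (s : K) ^ (e + 4) = a / b := by
        rw [hs, Units.val_mk0, div_pow, div_eq_div_iff (pow_ne_zero _ ha) hb, h2, ← h1]
        ring
      have hs2 : (s : K) ^ (e + 4 + 1) = r / b := by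
        rw [pow_succ, hs1, hs, Units.val_mk0]
        field_simp
      have hmk : QuotientGroup.mk' (Subgroup.center (GL (Fin 3) K)) A = ψ s := by
        rw [hψ, MonoidHom.comp_apply, eq_comm, QuotientGroup.mk'_apply, QuotientGroup.mk'_apply,
          QuotientGroup.eq, mem_center_GL]
        refine ⟨b, ?_⟩
        rw [Units.val_mul, Units.inv_mul_eq_iff_eq_mul, torus_val, hAd, hs1, hs2,
          Matrix.diagonal_mul_diagonal]
        congr 1
        funext i
        fin_cases i <;> simp [hb]
      refine ⟨s, ?_, hmk.symm⟩
      rw [hψ, MonoidHom.comp_apply, QuotientGroup.mk'_apply, QuotientGroup.mk'_apply,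
          QuotientGroup.eq] at hmk
      have h3 := (autGL F).mul_mem (show A ∈ autGL F from ⟨c, hA⟩) (center_le_autGL hhom hmk)
      rwa [mul_inv_cancel_left] at h3
    · rintro _ ⟨s, hs, rfl⟩
      exact ⟨torus K (e + 4) s, hs, rfl⟩
  have hroots : T ≤ rootsOfUnity ((e + 4) * (e + 4) * (e + 5)) K := by
    rintro s ⟨c, hs⟩
    obtain ⟨a, b, r, hAd, h1, h2, h3⟩ := diag_of_aut hhom hns hβ hN hN3 _ hs
    rw [torus_val] at hAd
    obtain ⟨rfl, rfl, rfl⟩ := diag_vec_inj hAd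
    rw [mem_rootsOfUnity]
    apply Units.ext
    rw [Units.val_pow_eq_pow_val, Units.val_one]
    rcases h3 with h3 | h3
    · rw [one_pow, one_mul, ← h2, mul_one] at h3
      have h4 : (s : K) ^ ((e + 4) * (e + 4)) = 1 := by
        have h5 : (s : K) ^ (e + 4) ≠ 0 := pow_ne_zero _ s.ne_zero
        apply mul_left_cancel₀ h5
        rw [mul_one]
        nth_rewrite 2 [h3]
        ring
      rw [pow_mul, h4, one_pow]
    · rw [one_pow, ← h1, ← pow_mul] at h3
      rw [mul_assoc, mul_comm, pow_mul, ← h3, one_pow]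
  have : NeZero ((e + 4) * (e + 4) * (e + 5)) := ⟨by positivity⟩
  have hcycT : IsCyclic T := by
    exact isCyclic_of_injective (Subgroup.inclusion hroots) (Subgroup.inclusion_injective hroots)
  refine ⟨?_, ?_⟩
  · rw [hproj]
    exact isCyclic_of_surjective (ψ.subgroupMap T) (ψ.subgroupMap_surjective T)
  · have hs : orderOf (t ^ ℓ) = e + 4 := by
      rw [orderOf_pow_of_dvd hℓ (by rw [hord]; exact dvd_mul_right _ _), hord,
        Nat.mul_div_cancel_left _ (Nat.pos_of_ne_zero hℓ)]
    refine ⟨ψ (t ^ ℓ), ?_, ?_, torus K (e + 4) (t ^ ℓ), rfl, ((t ^ ℓ : Kˣ) : K), ?_, 1, ?_⟩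
    · rw [hproj]
      exact ⟨t ^ ℓ, pow_mem (show t ∈ T from ht) ℓ, rfl⟩
    · rw [orderOf_injective ψ (torus_mk_injective _), hs]; rfl
    · have := IsPrimitiveRoot.orderOf (t ^ ℓ)
      rw [hs] at this
      exact (IsPrimitiveRoot.coe_units_iff).2 this
    · rw [one_mul, inv_one, mul_one, torus_val]
      have h1 : ((t ^ ℓ : Kˣ) : K) ^ (e + 4) = 1 := by
        rw [← Units.val_pow_eq_pow_val, ← hs, pow_orderOf_eq_one, Units.val_one]
      rw [pow_succ _ (e + 4), h1, one_mul]

/-! ### Change of coordinates -/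

lemma mem_autGL_subst (Q B : GL (Fin 3) K) (F : MvPolynomial (Fin 3) K) :
    B ∈ autGL (substPoly (Q : Matrix (Fin 3) (Fin 3) K) F) ↔ Q * B * Q⁻¹ ∈ autGL F := by
  constructor
  · rintro ⟨c, hc⟩
    refine ⟨c, ?_⟩
    rw [Units.val_mul, Units.val_mul, substPoly_mul, substPoly_mul, hc, substPoly_smul,
      ← substPoly_mul, GL_mul_inv', substPoly_one]
  · rintro ⟨c, hc⟩
    refine ⟨c, ?_⟩
    rw [← substPoly_mul, ← substPoly_smul, ← hc, ← substPoly_mul]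
    congr 1
    rw [← Units.val_mul, ← Units.val_mul, inv_mul_cancel_right]

lemma concl_of_subst (Q : GL (Fin 3) K) {d : ℕ} {F : MvPolynomial (Fin 3) K}
    (h : Concl d (substPoly (Q : Matrix (Fin 3) (Fin 3) K) F)) : Concl d F := by
  set π := QuotientGroup.mk' (Subgroup.center (GL (Fin 3) K)) with hπ
  set κ : PGL3 K →* PGL3 K := (MulAut.conj (π Q)).toMonoidHom with hκ
  have hκπ : ∀ B, κ (π B) = π (Q * B * Q⁻¹) := by
    intro B
    rw [hκ, MulEquiv.toMonoidHom_eq_coe, MonoidHom.coe_coe, MulAut.conj_apply, map_mul, map_mul,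
      map_inv]
  have hproj : projAut F = (projAut (substPoly (Q : Matrix (Fin 3) (Fin 3) K) F)).map κ := by
    apply le_antisymm
    · rintro _ ⟨A, hA, rfl⟩
      refine ⟨π (Q⁻¹ * A * Q), ⟨Q⁻¹ * A * Q, ?_, rfl⟩, ?_⟩
      · have : Q * (Q⁻¹ * A * Q) * Q⁻¹ = A := by group
        exact (mem_autGL_subst Q _ F).2 (by rwa [this])
      · rw [hκπ]
        congr 1
        group
    · rintro _ ⟨_, ⟨B, hB, rfl⟩, rfl⟩
      exact ⟨Q * B * Q⁻¹, (mem_autGL_subst Q B F).1 hB, (hκπ B).symm⟩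
  obtain ⟨hcyc, g, hg, hgo, A, hA, ζ, hζ, P, hP⟩ := h
  refine ⟨?_, κ g, ?_, ?_, Q * A * Q⁻¹, ?_, ζ, hζ, P * Q⁻¹, ?_⟩
  · rw [hproj]
    exact isCyclic_of_surjective (κ.subgroupMap _) (κ.subgroupMap_surjective _)
  · rw [hproj]
    exact ⟨g, hg, rfl⟩
  · rw [orderOf_injective κ (MulAut.conj (π Q)).injective, hgo]
  · rw [← hκπ, ← hA]
  · rw [← hP]
    congr 1
    group

/-! ### Diagonal automorphisms and monomials -/

lemma coeff_subst_diagonal (x : Fin 3 → K) (F : MvPolynomial (Fin 3) K) (m : Fin 3 →₀ ℕ) :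
    coeff m (substPoly (Matrix.diagonal x) F) = (∏ i, x i ^ m i) * coeff m F := by
  have hX : ∀ i, substPoly (Matrix.diagonal x) (X i : MvPolynomial (Fin 3) K) = C (x i) * X i := by
    intro i
    rw [substPoly_X]
    simp [Matrix.diagonal_apply, MvPolynomial.smul_eq_C_mul]
  have hmon : ∀ (s : Fin 3 →₀ ℕ) (a : K), substPoly (Matrix.diagonal x) (monomial s a)
      = monomial s ((∏ i, x i ^ s i) * a) := by
    intro s a
    rw [monomial_eq, monomial_eq, Finsupp.prod_fintype _ _ (by simp), Fin.prod_univ_three,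
      Fin.prod_univ_three]
    simp only [substPoly_mul_poly, substPoly_C, substPoly_pow, hX, C_mul, C_pow, mul_pow]
    ring
  induction F using MvPolynomial.induction_on' with
  | monomial s a =>
    rw [hmon, coeff_monomial, coeff_monomial]
    by_cases h : s = m
    · subst h; simp
    · simp [h]
  | add p q hp hq => rw [substPoly_add, coeff_add, coeff_add, hp, hq, mul_add]

/-- The monomial `X_i ^ (d-1) * X_j` occurs in `F`, where `d = n + 1`. -/
def Occ (n : ℕ) (F : MvPolynomial (Fin 3) K) (i j : Fin 3) : Prop :=
  coeff (Finsupp.single i n + Finsupp.single j 1) F ≠ 0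

lemma coeff_ne_of_eval_ne {G : MvPolynomial (Fin 3) K} {n : ℕ} (hG : G.IsHomogeneous n)
    {i : Fin 3} (h : eval (Pi.single i 1) G ≠ 0) : coeff (Finsupp.single i n) G ≠ 0 := by
  rw [eval_eq] at h
  obtain ⟨m, hm, hne⟩ := Finset.exists_ne_zero_of_sum_ne_zero h
  have h1 : ∀ k, k ≠ i → m k = 0 := by
    intro k hk
    by_contra hmk
    apply right_ne_zero_of_mul hne
    refine Finset.prod_eq_zero (Finsupp.mem_support_iff.2 hmk) ?_
    rw [Pi.single_eq_of_ne hk, zero_pow hmk]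
  have h2 : m = Finsupp.single i (m i) := by
    ext k
    by_cases hk : k = i
    · subst hk; simp
    · rw [h1 k hk, Finsupp.single_eq_of_ne hk]
  have h3 := hG.degree_eq_sum_deg_support hm
  rw [← Finsupp.degree_apply, h2, Finsupp.degree_single] at h3
  rw [h3, ← h2]
  exact mem_support_iff.1 hm

lemma exists_occ {F : MvPolynomial (Fin 3) K} {n : ℕ} (hF : F.IsHomogeneous (n + 1))
    (hns : IsNonsingular F) (i : Fin 3) : ∃ j, Occ n F i j := by
  by_contra hcon
  push Not at hcon
  have : (Pi.single i 1 : Fin 3 → K) = 0 := by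
    apply hns
    intro j
    by_contra hj
    have h := coeff_ne_of_eval_ne hF.pderiv hj
    rw [coeff_pderiv] at h
    exact hcon j (left_ne_zero_of_mul h)
  simpa using congrFun this i

lemma exists_free [IsAlgClosed K] [CharZero K] {F : MvPolynomial (Fin 3) K} {n : ℕ}
    (hn : n ≠ 0) (hF : F.IsHomogeneous (n + 1))
    (hns : IsNonsingular F) (i : Fin 3) : ∃ m, coeff m F ≠ 0 ∧ m i = 0 := by
  by_contra hcon
  push Not at hcon
  have hdvd : X i ∣ F := by
    rw [X_dvd_iff_modMonomial_eq_zero]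
    ext m
    by_cases hm : Finsupp.single i 1 ≤ m
    · rw [coeff_modMonomial_of_le _ hm, coeff_zero]
    · rw [coeff_modMonomial_of_not_le _ hm, coeff_zero]
      by_contra h
      apply hm
      rw [Finsupp.single_le_iff]
      exact Nat.one_le_iff_ne_zero.2 (hcon m h)
  obtain ⟨H, hH⟩ := hdvd
  obtain ⟨j, k, hji, hki, hjk⟩ : ∃ j k : Fin 3, j ≠ i ∧ k ≠ i ∧ j ≠ k := by
    have aux : ∀ i : Fin 3, ∃ j k : Fin 3, j ≠ i ∧ k ≠ i ∧ j ≠ k := by decide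
    exact aux i
  obtain ⟨s, t, hst, h⟩ := exists_zero_on_line (hF.pderiv (i := i)) (by omega)
      (Pi.single j 1) (Pi.single k 1)
  set v : Fin 3 → K := s • Pi.single j 1 + t • Pi.single k 1 with hv
  have hvi : v i = 0 := by simp [hv, hji.symm, hki.symm]
  have hv0 : v = 0 := by
    apply hns
    intro l
    by_cases hl : l = i
    · rw [hl]; exact h
    · rw [hH, Derivation.leibniz, pderiv_X_of_ne (Ne.symm hl)]
      simp [hvi]
  rcases hst with hs | ht
  · exact hs (by simpa [hv, hjk, hjk.symm] using congrFun hv0 j)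
  · exact ht (by simpa [hv, hjk, hjk.symm] using congrFun hv0 k)

lemma univ_three {i j k : Fin 3} (hij : i ≠ j) (hik : i ≠ k) (hjk : j ≠ k) :
    (Finset.univ : Finset (Fin 3)) = {i, j, k} := by
  revert i j k; decide

lemma prod_three {M : Type*} [CommMonoid M] {i j k : Fin 3} (hij : i ≠ j) (hik : i ≠ k)
    (hjk : j ≠ k) (f : Fin 3 → M) : ∏ a, f a = f i * f j * f k := by
  rw [univ_three hij hik hjk, Finset.prod_insert (by simp [hij, hik]),
    Finset.prod_insert (by simp [hjk]), Finset.prod_singleton, mul_assoc]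

lemma all_three {i j k : Fin 3} (hij : i ≠ j) (hik : i ≠ k)
    (hjk : j ≠ k) (a : Fin 3) : a = i ∨ a = j ∨ a = k := by
  have := Finset.mem_univ a
  rw [univ_three hij hik hjk] at this
  simpa using this

section comb

variable {n ℓ : ℕ} {F : MvPolynomial (Fin 3) K} {x : Fin 3 → K} {c : K}

lemma occ_weight (hmon : ∀ m, coeff m F ≠ 0 → ∏ i, x i ^ m i = c) {i j : Fin 3}
    (h : Occ n F i j) : x i ^ n * x j = c := by
  rw [← hmon _ h]
  simp only [Finsupp.add_apply, pow_add, Finset.prod_mul_distrib]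
  congr 1
  · rw [Finset.prod_eq_single i]
    · simp
    · intro b _ hb; simp [hb.symm]
    · simp
  · rw [Finset.prod_eq_single j]
    · simp
    · intro b _ hb; simp [hb.symm]
    · simp

lemma path_contra [IsAlgClosed K] [CharZero K] (hn : 4 ≤ n) (hℓ : 2 ≤ ℓ)
    (hF : F.IsHomogeneous (n + 1)) (hns : IsNonsingular F) (hx : ∀ i, x i ≠ 0)
    (hmon : ∀ m, coeff m F ≠ 0 → ∏ i, x i ^ m i = c)
    (hord : ∀ N, (∀ i j, x i ^ N = x j ^ N) → ℓ * n ∣ N)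
    {i j k : Fin 3} (hij : i ≠ j) (hik : i ≠ k) (hjk : j ≠ k)
    (hki : Occ n F k i) (hij' : Occ n F i j) (hjj : ¬ Occ n F j j) (hkk : ¬ Occ n F k k) :
    False := by
  obtain ⟨m, hm, hmi⟩ := exists_free (by omega) hF hns i
  have hw := hmon m hm
  have hdeg : m j + m k = n + 1 := by
    have h := hF.degree_eq_sum_deg_support (mem_support_iff.2 hm)
    rw [← Finsupp.degree_apply, Finsupp.degree_eq_sum, univ_three hij hik hjk,
      Finset.sum_insert (by simp [hij, hik]), Finset.sum_insert (by simp [hjk]),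
      Finset.sum_singleton, hmi] at h
    omega
  rw [prod_three hij hik hjk, hmi, pow_zero, one_mul] at hw
  have h1 := occ_weight hmon hki
  have h2 := occ_weight hmon hij'
  have hxi := hx i
  set b := x j / x i with hb
  set κ := x k / x i with hκ
  have hκ0 : κ ≠ 0 := div_ne_zero (hx k) hxi
  have hjb : x j = b * x i := by rw [hb]; field_simp
  have hkκ : x k = κ * x i := by rw [hκ]; field_simp
  have hbκ : b = κ ^ n := by
    rw [hjb] at h2
    rw [hkκ] at h1
    apply mul_right_cancel₀ (pow_ne_zero (n + 1) hxi)
    linear_combination h2 - h1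
  have hpow : κ ^ (n * m j + m k) = κ ^ n := by
    rw [hkκ] at h1
    rw [hjb, hkκ, mul_pow, mul_pow, hbκ] at hw
    apply mul_right_cancel₀ (pow_ne_zero (n + 1) hxi)
    calc κ ^ (n * m j + m k) * x i ^ (n + 1)
        = (κ ^ n) ^ m j * x i ^ m j * (κ ^ m k * x i ^ m k) := by rw [← hdeg]; ring
      _ = κ ^ n * x i ^ (n + 1) := by rw [hw, ← h1]; ring
  have hkey : ∀ N, κ ^ N = 1 → ℓ * n ∣ N := by
    intro N hN
    have h3 : ∀ a, x a ^ N = x i ^ N := by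
      intro a
      rcases all_three hij hik hjk a with rfl | rfl | rfl
      · rfl
      · rw [hjb, mul_pow, hbκ, ← pow_mul, mul_comm n N, pow_mul, hN, one_pow, one_mul]
      · rw [hkκ, mul_pow, hN, one_mul]
    exact hord N fun a b => (h3 a).trans (h3 b).symm
  have hext : ∀ m' : Fin 3 →₀ ℕ, m i = m' i → m j = m' j → m k = m' k → m = m' := by
    intro m' h1 h2 h3
    ext a
    rcases all_three hij hik hjk a with rfl | rfl | rfl <;> assumption
  rcases Nat.eq_zero_or_pos (m j) with hu | hu
  · apply hkk
    have : m = Finsupp.single k n + Finsupp.single k 1 := by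
      apply hext
      · simp [hmi, hik]
      · simp [hu, hjk]
      · simp; omega
    rw [this] at hm
    exact hm
  · obtain ⟨u, hu'⟩ : ∃ u, m j = u + 1 := ⟨m j - 1, by omega⟩
    have h4 : κ ^ (n * u + m k) = 1 := by
      apply mul_right_cancel₀ (pow_ne_zero n hκ0)
      rw [one_mul, ← pow_add]
      rw [show n * u + m k + n = n * m j + m k by rw [hu']; ring]
      exact hpow
    have h5 := hkey _ h4
    have h6 : n ∣ m k := by
      have := (Dvd.dvd.trans (dvd_mul_left n ℓ) h5)
      exact (Nat.dvd_add_right (dvd_mul_right n u)).1 this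
    obtain ⟨q, hq⟩ := h6
    have hq1 : q < 2 := by
      by_contra h
      have : n * 2 ≤ n * q := Nat.mul_le_mul_left n (by omega)
      omega
    interval_cases q
    · apply hjj
      have : m = Finsupp.single j n + Finsupp.single j 1 := by
        apply hext
        · simp [hmi, hij]
        · simp; omega
        · simp [hjk.symm]; omega
      rw [this] at hm
      exact hm
    · have hu0 : u = 0 := by omega
      rw [hu0, hq, mul_zero, zero_add, mul_one] at h5
      have := Nat.le_of_dvd (by omega) h5
      nlinarith

lemma exists_pqr [IsAlgClosed K] [CharZero K] (hn : 4 ≤ n) (hℓ : 2 ≤ ℓ)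
    (hF : F.IsHomogeneous (n + 1)) (hns : IsNonsingular F) (hx : ∀ i, x i ≠ 0)
    (hmon : ∀ m, coeff m F ≠ 0 → ∏ i, x i ^ m i = c)
    (hord : ∀ N, (∀ i j, x i ^ N = x j ^ N) → ℓ * n ∣ N) :
    ∃ p q r : Fin 3, p ≠ q ∧ p ≠ r ∧ q ≠ r ∧ Occ n F p p ∧ Occ n F r q := by
  by_contra hcon
  have hcon' : ∀ p q r : Fin 3, p ≠ q → p ≠ r → q ≠ r → Occ n F p p → ¬ Occ n F r q :=
    fun p q r h1 h2 h3 h4 h5 => hcon ⟨p, q, r, h1, h2, h3, h4, h5⟩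
  have hocc := exists_occ hF hns
  have hbig : 2 * n ≤ ℓ * n := Nat.mul_le_mul_right n hℓ
  by_cases hex : ∃ p, Occ n F p p
  · obtain ⟨p, hp⟩ := hex
    by_cases hall : ∀ i, Occ n F i i
    · have h := hord (n + 1) (fun i j => by
        rw [pow_succ, pow_succ, occ_weight hmon (hall i), occ_weight hmon (hall j)])
      have := Nat.le_of_dvd (by omega) h
      omega
    · have hto : ∀ r, r ≠ p → ¬ Occ n F r r → Occ n F r p := by
        intro r hrp hrr
        obtain ⟨s, hs⟩ := hocc r
        by_cases h1 : s = p
        · rwa [h1] at hs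
        · by_cases h2 : s = r
          · rw [h2] at hs; exact absurd hs hrr
          · exact absurd hs (hcon' p s r (Ne.symm h1) hrp.symm h2 hp)
      push Not at hall
      obtain ⟨r, hrr⟩ := hall
      have hrp : r ≠ p := fun h => hrr (h ▸ hp)
      have hr := hto r hrp hrr
      have hall2 : ∀ q, Occ n F q p := by
        intro q
        by_cases hqp : q = p
        · rw [hqp]; exact hp
        by_cases hqr : q = r
        · rw [hqr]; exact hr
        · apply hto q hqp
          intro hqq
          exact hcon' q p r hqp hqr hrp.symm hqq hr
      have h := hord n (fun i j => by
        apply mul_right_cancel₀ (hx p)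
        rw [occ_weight hmon (hall2 i), occ_weight hmon (hall2 j)])
      have := Nat.le_of_dvd (by omega) h
      omega
  · have hno : ∀ i, ¬ Occ n F i i := fun i h => hex ⟨i, h⟩
    have hpath : ∀ {i j k : Fin 3}, i ≠ j → i ≠ k → j ≠ k → Occ n F k i → ¬ Occ n F i j :=
      fun h1 h2 h3 h4 h5 => path_contra hn hℓ hF hns hx hmon hord h1 h2 h3 h4 h5 (hno _) (hno _)
    have hback : ∀ k i, Occ n F k i → Occ n F i k := by
      intro k i h
      have hki : k ≠ i := fun h' => hno k (by rw [← h'] at h; exact h)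
      obtain ⟨j, hj⟩ := hocc i
      have hij : i ≠ j := fun h' => hno i (by rw [← h'] at hj; exact hj)
      by_cases hjk : j = k
      · rwa [hjk] at hj
      · exact absurd hj (hpath hij hki.symm hjk h)
    obtain ⟨i, hi⟩ := hocc 0
    have h0i : 0 ≠ i := fun h' => hno 0 (by rw [← h'] at hi; exact hi)
    obtain ⟨k, hk0, hki⟩ : ∃ k : Fin 3, k ≠ 0 ∧ k ≠ i := by
      have aux : ∀ i : Fin 3, ∃ k : Fin 3, k ≠ 0 ∧ k ≠ i := by decide
      exact aux i
    obtain ⟨j, hj⟩ := hocc k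
    have hkj : k ≠ j := fun h' => hno k (by rw [← h'] at hj; exact hj)
    rcases all_three hk0.symm h0i hki j with rfl | rfl | rfl
    · exact hpath h0i hk0.symm hki.symm hj hi
    · exact hkj rfl
    · exact hpath h0i.symm hki.symm hk0.symm hj (hback _ _ hi)

end comb

/-! ### Reduction of a diagonal automorphism to the normal form -/

lemma degree_three {F : MvPolynomial (Fin 3) K} {d : ℕ} (hF : F.IsHomogeneous d)
    {m : Fin 3 →₀ ℕ} (hm : coeff m F ≠ 0) : m 0 + m 1 + m 2 = d := by
  have h := hF.degree_eq_sum_deg_support (mem_support_iff.2 hm)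
  rw [← Finsupp.degree_apply, Finsupp.degree_eq_sum, Fin.sum_univ_three] at h
  exact h.symm

lemma concl_diag0 [IsAlgClosed K] [CharZero K] {e ℓ : ℕ} {F : MvPolynomial (Fin 3) K}
    {x : Fin 3 → K} {c : K} (hℓ : 2 ≤ ℓ)
    (hhom : F.IsHomogeneous (e + 5)) (hns : IsNonsingular F) (hx : ∀ i, x i ≠ 0)
    (hmon : ∀ m, coeff m F ≠ 0 → ∏ i, x i ^ m i = c)
    (hord : ∀ N, (∀ i j, x i ^ N = x j ^ N) → ℓ * (e + 4) ∣ N)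
    (hconv : ∀ i j, x i ^ (ℓ * (e + 4)) = x j ^ (ℓ * (e + 4)))
    (h00 : Occ (e + 4) F 0 0) (h21 : Occ (e + 4) F 2 1) : Concl (e + 5) F := by
  have hw0 := occ_weight hmon h00
  have hw2 := occ_weight hmon h21
  have hx0 := hx 0
  have hx1 := hx 1
  set T := x 2 / x 0 with hT
  have hT0 : T ≠ 0 := div_ne_zero (hx 2) hx0
  have hx2T : x 2 = T * x 0 := by rw [hT]; field_simp
  have hx0T : x 0 = T ^ (e + 4) * x 1 := by
    rw [hx2T] at hw2
    apply mul_left_cancel₀ (pow_ne_zero (e + 4) hx0)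
    rw [hw0, ← hw2]
    ring
  have hx2T' : x 2 = T ^ (e + 5) * x 1 := by
    rw [hx2T, hx0T]
    ring
  have hc : c = T ^ ((e + 4) * (e + 5)) * x 1 ^ (e + 5) := by
    rw [← hw0, hx0T]
    ring
  set t : Kˣ := Units.mk0 T hT0 with ht
  have htpow : ∀ N, t ^ N = 1 ↔ T ^ N = 1 := by
    intro N
    rw [Units.ext_iff]
    simp [ht]
  have horder : orderOf t = ℓ * (e + 4) := by
    apply Nat.dvd_antisymm
    · apply orderOf_dvd_of_pow_eq_one
      rw [htpow, hT, div_pow, hconv 2 0, div_self (pow_ne_zero _ hx0)]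
    · have h1 : T ^ orderOf t = 1 := (htpow _).1 (pow_orderOf_eq_one t)
      have h2 : ∀ i, x i ^ orderOf t = x 1 ^ orderOf t := by
        intro i
        fin_cases i
        · change x 0 ^ orderOf t = _
          rw [hx0T, mul_pow, ← pow_mul, mul_comm (e + 4), pow_mul, h1, one_pow, one_mul]
        · rfl
        · change x 2 ^ orderOf t = _
          rw [hx2T', mul_pow, ← pow_mul, mul_comm (e + 5), pow_mul, h1, one_pow, one_mul]
      exact hord _ fun i j => (h2 i).trans (h2 j).symm
  have hTmon : ∀ m, coeff m F ≠ 0 →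
      T ^ ((e + 4) * m 0 + (e + 5) * m 2) = T ^ ((e + 4) * (e + 5)) := by
    intro m hm
    have h1 := hmon m hm
    have h2 := degree_three hhom hm
    rw [Fin.prod_univ_three, hc, hx2T', hx0T] at h1
    apply mul_right_cancel₀ (pow_ne_zero (e + 5) hx1)
    rw [← h1, ← h2]
    ring
  have hmod : ∀ m, coeff m F ≠ 0 →
      (e + 4) * m 0 + (e + 5) * m 2 ≡ (e + 4) * (e + 5) [MOD ℓ * (e + 4)] := by
    intro m hm
    rw [← horder, ← pow_eq_pow_iff_modEq]
    apply Units.ext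
    simpa [ht] using hTmon m hm
  have hbig : ¬ ℓ * (e + 4) ∣ e + 4 := by
    intro h
    have := Nat.le_of_dvd (by omega) h
    nlinarith
  have hz : ∀ m, coeff m F ≠ 0 → m 2 ≠ 0 →
      m = Finsupp.single 2 (e + 4) + Finsupp.single 1 1 := by
    intro m hm hm2
    have h1 := hmod m hm
    have h2 := degree_three hhom hm
    have h3 : e + 4 ∣ m 2 := by
      have h4 := h1.of_mul_left ℓ
      have h5 : (e + 4) * m 0 + (e + 5) * m 2 ≡ 0 [MOD (e + 4)] :=
        h4.trans ((Nat.modEq_zero_iff_dvd).2 (dvd_mul_right _ _))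
      rw [Nat.modEq_zero_iff_dvd] at h5
      have h6 : (e + 4) * m 0 + (e + 5) * m 2 = (e + 4) * (m 0 + m 2) + m 2 := by ring
      rw [h6] at h5
      exact (Nat.dvd_add_right (dvd_mul_right _ _)).1 h5
    obtain ⟨q, hq⟩ := h3
    have hq1 : q < 2 := by
      by_contra h
      have : (e + 4) * 2 ≤ (e + 4) * q := Nat.mul_le_mul_left _ (by omega)
      omega
    interval_cases q
    · omega
    have hm0 : m 0 = 0 := by
      by_contra h0
      have h01 : m 0 = 1 := by omega
      rw [h01, hq] at h1
      apply hbig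
      rw [← Nat.modEq_zero_iff_dvd]
      apply Nat.ModEq.add_right_cancel' ((e + 4) * (e + 5))
      convert h1 using 1 <;> ring
    ext i
    fin_cases i
    · simpa using hm0
    · simp; omega
    · simp; omega
  refine concl_normal (β := coeff (Finsupp.single 2 (e + 4) + Finsupp.single 1 1) F * ((e + 3 : ℕ) + 1))
    hhom hns ?_ ?_ ?_ (by omega : ℓ ≠ 0) t ?_ horder
  · exact mul_ne_zero h21 (Nat.cast_add_one_ne_zero (e + 3))
  · have hmonom : (X 2 ^ (e + 3) * X 1 : MvPolynomial (Fin 3) K)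
        = monomial (Finsupp.single 2 (e + 3) + Finsupp.single 1 1) 1 := by
      rw [X_pow_eq_monomial, X, monomial_mul, one_mul]
    have hs : (Finsupp.single 2 (e + 3) + Finsupp.single 1 1 + Finsupp.single 2 1 : Fin 3 →₀ ℕ)
        = Finsupp.single 2 (e + 4) + Finsupp.single 1 1 := by
      rw [add_right_comm, ← Finsupp.single_add]
    ext m
    rw [coeff_pderiv, hmonom, coeff_C_mul, coeff_monomial]
    by_cases hm : Finsupp.single 2 (e + 3) + Finsupp.single 1 1 = m
    · subst hm
      rw [hs, if_pos rfl]
      simp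
    · rw [if_neg hm, mul_zero]
      by_cases h0 : coeff (m + Finsupp.single 2 1) F = 0
      · rw [h0, zero_mul]
      · exfalso
        have h1 := hz _ h0 (by simp)
        rw [← hs] at h1
        exact hm (add_right_cancel h1).symm
  · by_contra hne
    have h1 := coeff_ne_of_eval_ne (n := e + 4) (hhom.pderiv) hne
    rw [coeff_pderiv] at h1
    have h2 := hmod _ (left_ne_zero_of_mul h1)
    simp at h2
    apply hbig
    rw [← Nat.modEq_zero_iff_dvd]
    apply Nat.ModEq.add_left_cancel' ((e + 4) * (e + 4))
    apply Nat.ModEq.symm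
    convert h2 using 1 <;> ring
  · refine ⟨t ^ ((e + 4) * (e + 5)), ?_⟩
    ext m
    rw [torus_val, coeff_subst_diagonal, coeff_smul, smul_eq_mul]
    by_cases hm : coeff m F = 0
    · rw [hm, mul_zero, mul_zero]
    · congr 1
      rw [Units.val_pow_eq_pow_val]
      change _ = T ^ _
      rw [← hTmon m hm, Fin.prod_univ_three]
      change (T ^ (e + 4)) ^ m 0 * 1 ^ m 1 * (T ^ (e + 5)) ^ m 2 = _
      rw [one_pow, mul_one, ← pow_mul, ← pow_mul, ← pow_add]

/-- The permutation matrix of `σ`. -/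
lemma exists_perm (σ : Equiv.Perm (Fin 3)) : ∃ Q : GL (Fin 3) K,
    (∀ F : MvPolynomial (Fin 3) K, substPoly (Q : Matrix (Fin 3) (Fin 3) K) F
      = rename σ.symm F) := by
  have hsub : ∀ (τ : Equiv.Perm (Fin 3)) (F : MvPolynomial (Fin 3) K),
      substPoly (Matrix.of fun i j => if τ i = j then (1 : K) else 0) F = rename τ F := by
    intro τ F
    unfold substPoly
    rw [rename_eq_aeval]
    congr 2
    funext i
    simp
  have hmul : ∀ τ : Equiv.Perm (Fin 3),
      (Matrix.of fun i j => if τ i = j then (1 : K) else 0) *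
      (Matrix.of fun i j => if τ.symm i = j then (1 : K) else 0) = 1 := by
    intro τ
    ext i j
    rw [Matrix.mul_apply, Finset.sum_eq_single (τ i)]
    · simp [Matrix.one_apply]
    · intro b _ hb
      simp [hb.symm]
    · simp
  exact ⟨⟨_, _, hmul σ.symm, hmul σ⟩, hsub σ.symm⟩

lemma concl_diag [IsAlgClosed K] [CharZero K] {e ℓ : ℕ} {F : MvPolynomial (Fin 3) K}
    {x : Fin 3 → K} {c : K} (hℓ : 2 ≤ ℓ)
    (hhom : F.IsHomogeneous (e + 5)) (hns : IsNonsingular F) (hx : ∀ i, x i ≠ 0)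
    (hmon : ∀ m, coeff m F ≠ 0 → ∏ i, x i ^ m i = c)
    (hord : ∀ N, (∀ i j, x i ^ N = x j ^ N) → ℓ * (e + 4) ∣ N)
    (hconv : ∀ i j, x i ^ (ℓ * (e + 4)) = x j ^ (ℓ * (e + 4))) : Concl (e + 5) F := by
  obtain ⟨p, q, r, hpq, hpr, hqr, hp, hr⟩ :=
    exists_pqr (n := e + 4) (by omega) hℓ hhom hns hx hmon hord
  have hinj : Function.Injective ![p, q, r] := by
    intro i j h
    fin_cases i <;> fin_cases j <;> simp_all [eq_comm]
  set σ : Equiv.Perm (Fin 3) := Equiv.ofBijective _ (Finite.injective_iff_bijective.1 hinj) with hσ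
  have h0 : σ 0 = p := rfl
  have h1 : σ 1 = q := rfl
  have h2 : σ 2 = r := rfl
  have h0' : σ.symm p = 0 := by rw [← h0, Equiv.symm_apply_apply]
  have h1' : σ.symm q = 1 := by rw [← h1, Equiv.symm_apply_apply]
  have h2' : σ.symm r = 2 := by rw [← h2, Equiv.symm_apply_apply]
  obtain ⟨Q, hQ⟩ := exists_perm (K := K) σ
  have hocc : ∀ i j, Occ (e + 4) F i j → Occ (e + 4) (rename σ.symm F) (σ.symm i) (σ.symm j) := by
    intro i j h
    unfold Occ at h ⊢
    rw [← Finsupp.mapDomain_single (f := σ.symm), ← Finsupp.mapDomain_single (f := σ.symm) (b := 1),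
      ← Finsupp.mapDomain_add, coeff_rename_mapDomain _ σ.symm.injective]
    exact h
  apply concl_of_subst Q
  have hnsQ := isNonsingular_subst Q hns
  have hhomQ := substPoly_isHomogeneous (Q : Matrix (Fin 3) (Fin 3) K) hhom
  rw [hQ] at hnsQ hhomQ ⊢
  refine concl_diag0 (x := x ∘ σ) (c := c) hℓ hhomQ hnsQ (fun i => hx _) ?_ ?_
    (fun i j => hconv _ _) ?_ ?_
  · intro m hm
    have hmm : Finsupp.mapDomain σ.symm (Finsupp.mapDomain σ m) = m := by
      rw [← Finsupp.mapDomain_comp, Equiv.symm_comp_self, Finsupp.mapDomain_id]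
    rw [← hmm, coeff_rename_mapDomain _ σ.symm.injective] at hm
    rw [← hmon _ hm, ← Equiv.prod_comp σ (fun i => x i ^ (Finsupp.mapDomain σ m) i)]
    apply Finset.prod_congr rfl
    intro i _
    rw [Finsupp.mapDomain_apply σ.injective]
    rfl
  · intro N hN
    apply hord
    intro i j
    have := hN (σ.symm i) (σ.symm j)
    simpa using this
  · have := hocc _ _ hp
    rwa [h0'] at this
  · have := hocc _ _ hr
    rwa [h1', h2'] at this

/-! ### Diagonalization of automorphisms of finite order -/

lemma exists_diagonalize [IsAlgClosed K] [CharZero K] (A : GL (Fin 3) K) {n : ℕ} (hn : n ≠ 0)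
    (hA : A ^ n ∈ Subgroup.center (GL (Fin 3) K)) :
    ∃ (P : GL (Fin 3) K) (x : Fin 3 → K),
      ((P⁻¹ * A * P : GL (Fin 3) K) : Matrix (Fin 3) (Fin 3) K) = Matrix.diagonal x := by
  obtain ⟨u, hu⟩ := mem_center_GL.1 hA
  have hu' : (Matrix.diagonal ![u, u, u] : Matrix (Fin 3) (Fin 3) K) = u • 1 := by
    ext i j
    fin_cases i <;> fin_cases j <;> simp
  rw [hu', Units.val_pow_eq_pow_val] at hu
  have hu0 : u ≠ 0 := by
    rintro rfl
    have h := GL_mul_inv' (A ^ n)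
    rw [Units.val_pow_eq_pow_val, hu, zero_smul, zero_mul] at h
    exact zero_ne_one h
  set f : Module.End K (Fin 3 → K) := Matrix.toLin' (A : Matrix (Fin 3) (Fin 3) K) with hf
  have hss : f.IsSemisimple := by
    apply Module.End.isSemisimple_of_squarefree_aeval_eq_zero
      (p := Polynomial.X ^ n - Polynomial.C u)
    · exact (Polynomial.separable_X_pow_sub_C u (by exact_mod_cast hn) hu0).squarefree
    · rw [map_sub, map_pow, Polynomial.aeval_X, Polynomial.aeval_C, hf, ← Matrix.toLin'_pow, hu,
        map_smul, Matrix.toLin'_one, sub_eq_zero]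
      rfl
  have htop := hss.iSup_eigenspace_eq_top
  obtain ⟨b, hbt, hspan, hli⟩ := exists_linearIndependent K
    {v : Fin 3 → K | ∃ μ : K, (A : Matrix (Fin 3) (Fin 3) K) *ᵥ v = μ • v}
  have hspan' : Submodule.span K b = ⊤ := by
    rw [hspan, eq_top_iff, ← htop]
    apply iSup_le
    intro μ v hv
    apply Submodule.subset_span
    exact ⟨μ, by simpa [hf] using Module.End.mem_eigenspace_iff.1 hv⟩
  let B0 : Module.Basis b K (Fin 3 → K) := Module.Basis.mk hli (by rw [Subtype.range_coe, hspan'])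
  let B := B0.reindex (B0.indexEquiv (Pi.basisFun K (Fin 3)))
  have hB : ∀ i, ∃ μ : K, (A : Matrix (Fin 3) (Fin 3) K) *ᵥ B i = μ • B i := by
    intro i
    have : B i ∈ b := by
      simp [B, B0]
    exact hbt this
  choose x hx using hB
  let E := Pi.basisFun K (Fin 3)
  let P : GL (Fin 3) K := ⟨E.toMatrix B, B.toMatrix E, E.toMatrix_mul_toMatrix_flip B,
    B.toMatrix_mul_toMatrix_flip E⟩
  refine ⟨P, x, ?_⟩
  have hAP : (A : Matrix (Fin 3) (Fin 3) K) * (P : Matrix (Fin 3) (Fin 3) K)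
      = (P : Matrix (Fin 3) (Fin 3) K) * Matrix.diagonal x := by
    ext i j
    rw [Matrix.mul_diagonal]
    have h := congrFun (hx j) i
    simp only [Pi.smul_apply, smul_eq_mul] at h
    have hP : ∀ a, (P : Matrix (Fin 3) (Fin 3) K) a j = B j a := by
      intro a
      simp [P, E, Module.Basis.toMatrix_apply]
    rw [hP, mul_comm, ← h, Matrix.mul_apply]
    simp only [hP]
    rfl
  rw [Units.val_mul, Units.val_mul, mul_assoc, hAP, ← mul_assoc, GL_inv_mul', one_mul]

/-- if a nonsingular plane curve of degree `d ≥ 5` has an automorphism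
of order `ℓ(d-1)` for some `2 ≤ ℓ ≤ d-1`, then its automorphism group is cyclic and
contains a homology of period `d-1`, i.e. an element of order `d-1` represented by a
matrix conjugate in `GL₃(K)` to `diag(1,1,ζ)` with `ζ` a primitive `(d-1)`-th root of
unity. -/
theorem stmt12 {K : Type*} [Field K] [IsAlgClosed K] [CharZero K]
    (d ℓ : ℕ) (hd : 5 ≤ d) (hℓ1 : 2 ≤ ℓ) (hℓ2 : ℓ ≤ d - 1)
    (F : MvPolynomial (Fin 3) K)
    (hhom : F.IsHomogeneous d) (hns : IsNonsingular F)
    (h : ∃ g ∈ projAut F, orderOf g = ℓ * (d - 1)) :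
    IsCyclic ↥(projAut F) ∧
    ∃ g ∈ projAut F, orderOf g = d - 1 ∧
      ∃ A : GL (Fin 3) K,
        QuotientGroup.mk' (Subgroup.center (GL (Fin 3) K)) A = g ∧
        ∃ ζ : K, IsPrimitiveRoot ζ (d - 1) ∧
          ∃ P : GL (Fin 3) K,
            ((P * A * P⁻¹ : GL (Fin 3) K) : Matrix (Fin 3) (Fin 3) K)
              = Matrix.diagonal ![1, 1, ζ] := by
  obtain ⟨e, rfl⟩ : ∃ e, d = e + 5 := ⟨d - 5, by omega⟩
  obtain ⟨g, ⟨A, hA, rfl⟩, hg⟩ := h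
  have hd1 : e + 5 - 1 = e + 4 := by omega
  rw [hd1] at hg
  have hpow : ∀ N, A ^ N ∈ Subgroup.center (GL (Fin 3) K) ↔ ℓ * (e + 4) ∣ N := by
    intro N
    rw [← hg, orderOf_dvd_iff_pow_eq_one, ← map_pow, QuotientGroup.mk'_apply,
      QuotientGroup.eq_one_iff]
  have hn0 : ℓ * (e + 4) ≠ 0 := Nat.mul_ne_zero (by omega) (by omega)
  obtain ⟨P, x, hP⟩ := exists_diagonalize A hn0 ((hpow _).2 dvd_rfl)
  set D : GL (Fin 3) K := P⁻¹ * A * P with hD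
  have hPD : P * D * P⁻¹ = A := by rw [hD]; group
  have hDaut : D ∈ autGL (substPoly (P : Matrix (Fin 3) (Fin 3) K) F) := by
    rw [mem_autGL_subst, hPD]
    exact hA
  have hx : ∀ i, x i ≠ 0 := by
    intro i hi
    have h := congrFun (congrFun (GL_mul_inv' D) i) i
    rw [hP, Matrix.diagonal_mul, hi, zero_mul, Matrix.one_apply_eq] at h
    exact zero_ne_one h
  have hcen : ∀ N, A ^ N ∈ Subgroup.center (GL (Fin 3) K) ↔ ∀ i j, x i ^ N = x j ^ N := by
    intro N
    have h1 : A ^ N ∈ Subgroup.center (GL (Fin 3) K) ↔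
        D ^ N ∈ Subgroup.center (GL (Fin 3) K) := by
      rw [← hPD, conj_pow]
      constructor
      · intro h
        have := (inferInstance : (Subgroup.center (GL (Fin 3) K)).Normal).conj_mem _ h P⁻¹
        convert this using 1
        group
      · intro h
        exact (inferInstance : (Subgroup.center (GL (Fin 3) K)).Normal).conj_mem _ h P
    rw [h1, mem_center_GL, Units.val_pow_eq_pow_val, hP, Matrix.diagonal_pow]
    constructor
    · rintro ⟨u, hu⟩
      have h2 := Matrix.diagonal_injective hu
      have h3 : ∀ i, x i ^ N = u := by
        intro i
        have h4 := congrFun h2 i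
        fin_cases i <;> simpa using h4
      intro i j
      rw [h3, h3]
    · intro h
      refine ⟨x 0 ^ N, ?_⟩
      congr 1
      funext i
      have h4 := h i 0
      fin_cases i <;> simpa using h4
  obtain ⟨c, hc⟩ := hDaut
  have hmon : ∀ m, coeff m (substPoly (P : Matrix (Fin 3) (Fin 3) K) F) ≠ 0 →
      ∏ i, x i ^ m i = (c : K) := by
    intro m hm
    have h := congrArg (coeff m) hc
    rw [hP, coeff_subst_diagonal, coeff_smul, smul_eq_mul] at h
    exact mul_right_cancel₀ hm h
  exact concl_of_subst P (concl_diag hℓ1 (substPoly_isHomogeneous _ hhom)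
    (isNonsingular_subst P hns) hx hmon
    (fun N hN => (hpow N).1 ((hcen N).2 hN)) ((hcen _).1 ((hpow _).2 dvd_rfl)))

end
end

section
/- Let K be an algebraically closed field of characteristic 0, let d ≥ 5 be an odd integer, and let β ∈ K^× be such that F = X^d + X·(Z^{d−1} + Y^{d−1}) + β·Y²·Z^{d−2} is nonsingular. Then Aut(F) is the cyclic group of order d−1 generated by the class of the diagonal matrix diag(1, ζ_{d−1}, ζ_{d−1}²), where ζ_{d−1} ∈ K is a primitive (d−1)-th root of unity. -/
open MvPolynomial Matrix

noncomputable section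

variable {K : Type*} [Field K]

lemma pderiv_substPoly (A : Matrix (Fin 3) (Fin 3) K) (G : MvPolynomial (Fin 3) K) (j : Fin 3) :
    pderiv j (substPoly A G) = ∑ i, A i j • substPoly A (pderiv i G) := by
  induction G using MvPolynomial.induction_on with
  | C a => simp [substPoly]
  | add p q hp hq =>
    simp only [substPoly, map_add] at *
    rw [hp, hq, ← Finset.sum_add_distrib]
    simp only [smul_add]
  | mul_X p k hp =>
    have hX : pderiv j (∑ t, A k t • (X t : MvPolynomial (Fin 3) K)) = C (A k j) := by
      rw [map_sum]
      simp only [Derivation.map_smul, pderiv_X, Pi.single_apply, smul_ite, smul_zero,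
        Finset.sum_ite_eq', Finset.mem_univ, if_true]
      rw [MvPolynomial.smul_eq_C_mul, mul_one]
    have h1 : substPoly A (p * X k) = substPoly A p * ∑ t, A k t • X t := by
      simp [substPoly]
    have h2 : ∀ i, substPoly A (pderiv i (p * X k)) =
        substPoly A p * substPoly A ((Pi.single i 1 : Fin 3 → MvPolynomial (Fin 3) K) k)
          + (∑ t, A k t • X t) * substPoly A (pderiv i p) := by
      intro i
      simp [substPoly, Derivation.leibniz, pderiv_X]
    rw [h1, Derivation.leibniz, hX, hp]
    simp only [h2, smul_add, Finset.sum_add_distrib, smul_eq_mul]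
    congr 1
    · simp only [Pi.single_apply]
      fin_cases k <;> simp [Fin.sum_univ_three, substPoly, MvPolynomial.smul_eq_C_mul] <;> ring
    · rw [Finset.mul_sum]
      refine Finset.sum_congr rfl fun i _ => ?_
      rw [mul_smul_comm]

lemma substPoly_sum (A : Matrix (Fin 3) (Fin 3) K) {ι : Type*} (s : Finset ι)
    (G : ι → MvPolynomial (Fin 3) K) :
    substPoly A (∑ i ∈ s, G i) = ∑ i ∈ s, substPoly A (G i) := by
  simp [substPoly]

lemma pderiv3_substPoly (A : Matrix (Fin 3) (Fin 3) K) (G : MvPolynomial (Fin 3) K)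
    (a b c : Fin 3) :
    pderiv a (pderiv b (pderiv c (substPoly A G))) =
      substPoly A (∑ k, ∑ j, ∑ i, (A k c * A j b * A i a) • pderiv i (pderiv j (pderiv k G))) := by
  simp only [pderiv_substPoly, map_sum, Derivation.map_smul, substPoly_sum, substPoly_smul,
    Finset.smul_sum, smul_smul]

lemma eval_substPoly (A : Matrix (Fin 3) (Fin 3) K) (G : MvPolynomial (Fin 3) K) (x : Fin 3 → K) :
    eval x (substPoly A G) = eval (A *ᵥ x) G := by
  induction G using MvPolynomial.induction_on with
  | C a => simp [substPoly]
  | add p q hp hq => rw [substPoly_add, map_add, map_add, hp, hq]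
  | mul_X p k hp =>
    have h1 : substPoly A (p * X k) = substPoly A p * ∑ t, A k t • X t := by
      simp [substPoly]
    rw [h1, map_mul, map_mul, hp]
    simp [Matrix.mulVec, dotProduct, smul_eval]

/-- The monomial `a X^p Y^q Z^r`. -/
def mono3 (a : K) (p q r : ℕ) : MvPolynomial (Fin 3) K :=
  C a * X 0 ^ p * X 1 ^ q * X 2 ^ r

lemma pderiv_mono3_zero (a : K) (p q r : ℕ) :
    pderiv 0 (mono3 a p q r) = mono3 (a * p) (p - 1) q r := by
  simp [mono3, Derivation.leibniz, Derivation.leibniz_pow, pderiv_X]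
  ring

lemma pderiv_mono3_one (a : K) (p q r : ℕ) :
    pderiv 1 (mono3 a p q r) = mono3 (a * q) p (q - 1) r := by
  simp [mono3, Derivation.leibniz, Derivation.leibniz_pow, pderiv_X]
  ring

lemma pderiv_mono3_two (a : K) (p q r : ℕ) :
    pderiv 2 (mono3 a p q r) = mono3 (a * r) p q (r - 1) := by
  simp [mono3, Derivation.leibniz, Derivation.leibniz_pow, pderiv_X]
  ring

lemma eval_mono3 (a : K) (p q r : ℕ) (x : Fin 3 → K) :
    eval x (mono3 a p q r) = a * x 0 ^ p * x 1 ^ q * x 2 ^ r := by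
  simp [mono3]

/-- The polynomial, with `d = m + 5`. -/
def ourF (β : K) (m : ℕ) : MvPolynomial (Fin 3) K :=
  X 0 ^ (m + 5) + X 0 * (X 2 ^ (m + 4) + X 1 ^ (m + 4)) + C β * X 1 ^ 2 * X 2 ^ (m + 3)

lemma evalT (β : K) (m : ℕ) (s : Fin 3 → Fin 3 → Fin 3 → K) (x : Fin 3 → K) :
    eval x (∑ k, ∑ j, ∑ i, s i j k • pderiv i (pderiv j (pderiv k (ourF β m)))) =
      (m + 5) * (m + 4) * (m + 3) * x 0 ^ (m + 2) * s 0 0 0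
      + (m + 4) * (m + 3) * (m + 2) * x 0 * x 1 ^ (m + 1) * s 1 1 1
      + ((m + 4) * (m + 3) * (m + 2) * x 0 * x 2 ^ (m + 1)
          + β * (m + 3) * (m + 2) * (m + 1) * x 1 ^ 2 * x 2 ^ m) * s 2 2 2
      + (m + 4) * (m + 3) * x 1 ^ (m + 2) * (s 0 1 1 + s 1 0 1 + s 1 1 0)
      + 2 * β * (m + 3) * (m + 2) * x 1 * x 2 ^ (m + 1) * (s 1 2 2 + s 2 1 2 + s 2 2 1)
      + (m + 3) * x 2 ^ (m + 2) * ((m + 4) * (s 0 2 2 + s 2 0 2 + s 2 2 0)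
          + 2 * β * (s 1 1 2 + s 1 2 1 + s 2 1 1)) := by
  have h : ourF β m = mono3 1 (m + 5) 0 0 + mono3 1 1 0 (m + 4) + mono3 1 1 (m + 4) 0
      + mono3 β 0 2 (m + 3) := by
    simp [ourF, mono3]; ring
  rw [h]
  simp only [Fin.sum_univ_three, map_add, pderiv_mono3_zero, pderiv_mono3_one, pderiv_mono3_two,
    smul_eval, eval_mono3]
  simp
  ring

lemma sixCond [CharZero K] (β : K) (hβ : β ≠ 0) (m : ℕ) (s : Fin 3 → Fin 3 → Fin 3 → K)
    (h : ∑ k, ∑ j, ∑ i, s i j k • pderiv i (pderiv j (pderiv k (ourF β m))) = 0) :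
    s 0 0 0 = 0 ∧ s 1 1 1 = 0 ∧ s 2 2 2 = 0 ∧ s 0 1 1 + s 1 0 1 + s 1 1 0 = 0 ∧
    s 1 2 2 + s 2 1 2 + s 2 2 1 = 0 ∧
    (m + 4) * (s 0 2 2 + s 2 0 2 + s 2 2 0) + 2 * β * (s 1 1 2 + s 1 2 1 + s 2 1 1) = 0 := by
  have H : ∀ x, _ := fun x => evalT β m s x
  simp only [h, map_zero] at H
  have m1 : (m + 1 : K) ≠ 0 := by exact_mod_cast Nat.succ_ne_zero m
  have m2 : (m + 2 : K) ≠ 0 := by exact_mod_cast Nat.succ_ne_zero (m + 1)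
  have m3 : (m + 3 : K) ≠ 0 := by exact_mod_cast Nat.succ_ne_zero (m + 2)
  have m4 : (m + 4 : K) ≠ 0 := by exact_mod_cast Nat.succ_ne_zero (m + 3)
  have m5 : (m + 5 : K) ≠ 0 := by exact_mod_cast Nat.succ_ne_zero (m + 4)
  have a0 : s 0 0 0 = 0 := by
    have := H ![1, 0, 0]
    simpa [m1, m2, m3, m4, m5] using this
  have a5 := H ![0, 0, 1]
  simp [m3] at a5
  have a2 : s 2 2 2 = 0 := by
    have := H ![1, 0, 1]
    simpa [m1, m2, m3, m4, m5, a0, a5] using this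
  have a3 := H ![0, 1, 0]
  simp [m1, m2, m3, m4, a2] at a3
  have a1 : s 1 1 1 = 0 := by
    have := H ![1, 1, 0]
    simpa [m1, m2, m3, m4, m5, a0, a2, a3] using this
  have a4 := H ![0, 1, 1]
  simp [m1, m2, m3, m4, a2, a1, a3, a5, hβ] at a4
  exact ⟨a0, a1, a2, a3, a4, a5⟩

lemma substPoly_inj (A : GL (Fin 3) K) (G : MvPolynomial (Fin 3) K)
    (h : substPoly (A : Matrix (Fin 3) (Fin 3) K) G = 0) : G = 0 := by
  have h1 : (A : Matrix (Fin 3) (Fin 3) K) *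
      ((A⁻¹ : GL (Fin 3) K) : Matrix (Fin 3) (Fin 3) K) = 1 := by
    exact_mod_cast Units.mul_inv A
  rw [← substPoly_one G, ← h1, substPoly_mul, h]
  simp [substPoly]

/-- A relation between third partial derivatives, pulled back along `A`. -/
lemma pulled (β : K) (m : ℕ) (A : GL (Fin 3) K) (c : K)
    (hA : substPoly (A : Matrix (Fin 3) (Fin 3) K) (ourF β m) = c • ourF β m)
    (t t' : K) (p q r p' q' r' : Fin 3)
    (ht : t • pderiv p (pderiv q (pderiv r (ourF β m)))
      + t' • pderiv p' (pderiv q' (pderiv r' (ourF β m))) = 0) :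
    ∑ k, ∑ j, ∑ i, (t * (A k r * A j q * A i p) + t' * (A k r' * A j q' * A i p')) •
      pderiv i (pderiv j (pderiv k (ourF β m))) = 0 := by
  apply substPoly_inj A
  have key : ∀ a' b' c' : Fin 3, c • pderiv a' (pderiv b' (pderiv c' (ourF β m))) =
      substPoly A.1 (∑ k, ∑ j, ∑ i, (A k c' * A j b' * A i a') •
        pderiv i (pderiv j (pderiv k (ourF β m)))) := by
    intro a' b' c'
    rw [← pderiv3_substPoly, hA]
    simp only [Derivation.map_smul]
  have e : t • (c • pderiv p (pderiv q (pderiv r (ourF β m))))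
      + t' • (c • pderiv p' (pderiv q' (pderiv r' (ourF β m)))) = 0 := by
    simp only [smul_comm _ c, ← smul_add, ht, smul_zero]
  simp only [key, ← substPoly_smul, ← substPoly_add] at e
  rw [← e]
  congr 1
  simp only [add_smul, Finset.sum_add_distrib, Finset.smul_sum, smul_smul]

lemma rel_all (β : K) (m : ℕ) :
    pderiv 0 (pderiv 0 (pderiv 1 (ourF β m))) = 0 ∧
    pderiv 0 (pderiv 0 (pderiv 2 (ourF β m))) = 0 ∧
    pderiv 0 (pderiv 1 (pderiv 2 (ourF β m))) = 0 ∧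
    (2 * β) • pderiv 0 (pderiv 2 (pderiv 2 (ourF β m)))
      + (-(m + 4 : K)) • pderiv 1 (pderiv 1 (pderiv 2 (ourF β m))) = 0 := by
  have h : ourF β m = mono3 1 (m + 5) 0 0 + mono3 1 1 0 (m + 4) + mono3 1 1 (m + 4) 0
      + mono3 β 0 2 (m + 3) := by
    simp [ourF, mono3]; ring
  rw [h]
  simp only [map_add, pderiv_mono3_zero, pderiv_mono3_one, pderiv_mono3_two]
  simp [mono3, MvPolynomial.smul_eq_C_mul]
  have h2 : (C 2 : MvPolynomial (Fin 3) K) = 2 := rfl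
  have h3 : (C 3 : MvPolynomial (Fin 3) K) = 3 := rfl
  have h4 : (C 4 : MvPolynomial (Fin 3) K) = 4 := rfl
  simp only [h2, h3, h4]
  ring

lemma row_type [CharZero K] (β : K) (hβ : β ≠ 0) (m : ℕ) (a b c : K)
    (h1 : a * a * b = 0) (h2 : a * a * c = 0)
    (h4 : 2 * β * (a * c * c) - (m + 4) * (b * b * c) = 0) :
    (b = 0 ∧ c = 0) ∨ (a = 0 ∧ c = 0) ∨ (a = 0 ∧ b = 0) := by
  have m4 : (m + 4 : K) ≠ 0 := by exact_mod_cast Nat.succ_ne_zero (m + 3)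
  by_cases ha : a = 0
  · subst ha
    simp [m4] at h4
    tauto
  · simp [ha] at h1 h2
    exact Or.inl ⟨h1, h2⟩

lemma diag_of_aut_s14 [CharZero K] (β : K) (hβ : β ≠ 0) (m : ℕ) (A : GL (Fin 3) K) (c : K)
    (hA : substPoly (A : Matrix (Fin 3) (Fin 3) K) (ourF β m) = c • ourF β m) :
    (A 0 1 = 0 ∧ A 0 2 = 0) ∧ (A 1 0 = 0 ∧ A 1 2 = 0) ∧ (A 2 0 = 0 ∧ A 2 1 = 0) := by
  obtain ⟨r1, r2, r3, r4⟩ := rel_all β m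
  have q1 := sixCond β hβ m _ (pulled β m A c hA 1 0 0 0 1 0 0 1 (by simp [r1]))
  have q2 := sixCond β hβ m _ (pulled β m A c hA 1 0 0 0 2 0 0 2 (by simp [r2]))
  have q4 := sixCond β hβ m _ (pulled β m A c hA _ _ _ _ _ _ _ _ r4)
  have hdet : (A : Matrix (Fin 3) (Fin 3) K).det ≠ 0 := by
    have := (Matrix.isUnit_iff_isUnit_det _).1 A.isUnit
    exact this.ne_zero
  rw [Matrix.det_fin_three] at hdet
  have m4 : (m + 4 : K) ≠ 0 := by exact_mod_cast Nat.succ_ne_zero (m + 3)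
  generalize A 0 0 = a00 at *
  generalize A 0 1 = a01 at *
  generalize A 0 2 = a02 at *
  generalize A 1 0 = a10 at *
  generalize A 1 1 = a11 at *
  generalize A 1 2 = a12 at *
  generalize A 2 0 = a20 at *
  generalize A 2 1 = a21 at *
  generalize A 2 2 = a22 at *
  obtain ⟨u1, u2, u3, u4, u5, -⟩ := q1
  obtain ⟨v1, v2, v3, v4, v5, -⟩ := q2
  obtain ⟨w1, w2, w3, w4, w5, -⟩ := q4
  have t0 := row_type β hβ m a00 a01 a02 (by linear_combination u1) (by linear_combination v1)
    (by linear_combination w1)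
  have t1 := row_type β hβ m a10 a11 a12 (by linear_combination u2) (by linear_combination v2)
    (by linear_combination w2)
  have t2 := row_type β hβ m a20 a21 a22 (by linear_combination u3) (by linear_combination v3)
    (by linear_combination w3)
  rcases t0 with ⟨rfl, rfl⟩ | ⟨rfl, rfl⟩ | ⟨rfl, rfl⟩ <;>
  rcases t1 with ⟨rfl, rfl⟩ | ⟨rfl, rfl⟩ | ⟨rfl, rfl⟩ <;>
  rcases t2 with ⟨rfl, rfl⟩ | ⟨rfl, rfl⟩ | ⟨rfl, rfl⟩ <;>
  simp [hβ, m4] at * <;> tauto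

/-- For diagonal matrices, the precise form of an automorphism. -/
lemma aut_form (β : K) (hβ : β ≠ 0) (m : ℕ) (a b e c : K) (ha : a ≠ 0) (hb : b ≠ 0) (he : e ≠ 0)
    (h : ∀ x : Fin 3 → K, eval ![a * x 0, b * x 1, e * x 2] (ourF β m)
      = c * eval x (ourF β m)) :
    (b / a) ^ (m + 4) = 1 ∧ e = a * (b / a) ^ 2 := by
  have h1 := h ![1, 0, 0]
  have h2 := h ![1, 0, 1]
  have h3 := h ![1, 1, 0]
  have h4 := h ![0, 1, 1]
  simp [ourF] at h1 h2 h3 h4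
  have h2' : a * e ^ (m + 4) = c := by linear_combination h2 - h1
  have h3' : a * b ^ (m + 4) = c := by linear_combination h3 - h1
  have h4' : b ^ 2 * e ^ (m + 3) = c := by
    apply mul_left_cancel₀ hβ
    linear_combination h4
  have hb1 : b ^ (m + 4) = a ^ (m + 4) := by
    apply mul_left_cancel₀ ha
    rw [h3', ← h1]; ring
  refine ⟨by rw [div_pow, hb1, div_self (pow_ne_zero _ ha)], ?_⟩
  have h5 : a * e = b ^ 2 := by
    apply mul_right_cancel₀ (pow_ne_zero (m + 3) he)
    rw [h4', ← h2']; ring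
  field_simp
  linear_combination h5

lemma mk_eq_iff_scalar (A B : GL (Fin 3) K) (a : K)
    (h : (B : Matrix (Fin 3) (Fin 3) K) = a • (A : Matrix (Fin 3) (Fin 3) K)) :
    QuotientGroup.mk' (Subgroup.center (GL (Fin 3) K)) A
      = QuotientGroup.mk' (Subgroup.center (GL (Fin 3) K)) B := by
  rw [QuotientGroup.mk'_apply, QuotientGroup.mk'_apply, QuotientGroup.eq]
  rw [Matrix.GeneralLinearGroup.mem_center_iff_val_mem_range_scalar]
  refine ⟨a, ?_⟩
  have h1 : ((A⁻¹ : GL (Fin 3) K) : Matrix (Fin 3) (Fin 3) K) *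
      (A : Matrix (Fin 3) (Fin 3) K) = 1 := by
    exact_mod_cast Units.inv_mul A
  rw [Units.val_mul, h, mul_smul_comm, h1]
  ext i j
  simp [Matrix.scalar_apply, Matrix.diagonal_apply, Matrix.one_apply]

lemma pow_val (ζ : K) (A : GL (Fin 3) K)
    (hA : (A : Matrix (Fin 3) (Fin 3) K) = Matrix.diagonal ![1, ζ, ζ ^ 2]) (k : ℕ) :
    ((A ^ k : GL (Fin 3) K) : Matrix (Fin 3) (Fin 3) K)
      = Matrix.diagonal ![1, ζ ^ k, (ζ ^ k) ^ 2] := by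
  rw [Units.val_pow_eq_pow_val, hA, Matrix.diagonal_pow]
  congr 1
  funext i
  fin_cases i <;> simp [← pow_mul, mul_comm]

lemma gen_mem (β : K) (m : ℕ) (ζ : K) (hζ : ζ ^ (m + 4) = 1) (A : GL (Fin 3) K)
    (hA : (A : Matrix (Fin 3) (Fin 3) K) = Matrix.diagonal ![1, ζ, ζ ^ 2]) :
    A ∈ autGL (ourF β m) := by
  refine ⟨1, ?_⟩
  rw [hA]
  have e2 : (C ζ : MvPolynomial (Fin 3) K) ^ (m + 4) = 1 := by rw [← C_pow, hζ, C_1]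
  have e3 : ((C ζ : MvPolynomial (Fin 3) K) ^ 2) ^ (m + 4) = 1 := by
    rw [← pow_mul, mul_comm, pow_mul, e2, one_pow]
  have e4 : (C ζ : MvPolynomial (Fin 3) K) ^ 2 * (C ζ ^ 2) ^ (m + 3) = 1 := by
    rw [← e3]; ring
  simp [substPoly, ourF, Fin.sum_univ_three, MvPolynomial.smul_eq_C_mul, mul_pow, e2, e3]
  linear_combination (C β * X 1 ^ 2 * X 2 ^ (m + 3)) * e4

theorem stmt14 {K : Type*} [Field K] [IsAlgClosed K] [CharZero K]
    (d : ℕ) (hd : 5 ≤ d) (hodd : Odd d) (β : K) (hβ : β ≠ 0)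
    (F : MvPolynomial (Fin 3) K)
    (hF : F = X 0 ^ d + X 0 * (X 2 ^ (d - 1) + X 1 ^ (d - 1))
        + C β * X 1 ^ 2 * X 2 ^ (d - 2))
    (hns : IsNonsingular F)
    (ζ : K) (hζ : IsPrimitiveRoot ζ (d - 1))
    (A : GL (Fin 3) K)
    (hA : (A : Matrix (Fin 3) (Fin 3) K) = Matrix.diagonal ![1, ζ, ζ ^ 2]) :
    projAut F
      = Subgroup.zpowers (QuotientGroup.mk' (Subgroup.center (GL (Fin 3) K)) A) ∧
    Nat.card ↥(projAut F) = d - 1 := by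
  obtain ⟨m, rfl⟩ : ∃ m, d = m + 5 := ⟨d - 5, by omega⟩
  have hF' : F = ourF β m := hF
  have hζ' : IsPrimitiveRoot ζ (m + 4) := hζ
  subst hF'
  have main : projAut (ourF β m)
      = Subgroup.zpowers (QuotientGroup.mk' (Subgroup.center (GL (Fin 3) K)) A) := by
    apply le_antisymm
    · rintro _ ⟨B, ⟨c, hc⟩, rfl⟩
      obtain ⟨⟨z01, z02⟩, ⟨z10, z12⟩, z20, z21⟩ := diag_of_aut_s14 β hβ m B c hc
      have hdet : (B : Matrix (Fin 3) (Fin 3) K).det ≠ 0 :=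
        ((Matrix.isUnit_iff_isUnit_det _).1 B.isUnit).ne_zero
      rw [Matrix.det_fin_three] at hdet
      simp [z01, z02, z10, z12, z20, z21] at hdet
      obtain ⟨⟨n0, n1⟩, n2⟩ := hdet
      have hx : ∀ x : Fin 3 → K, eval ![B 0 0 * x 0, B 1 1 * x 1, B 2 2 * x 2] (ourF β m)
          = c * eval x (ourF β m) := by
        intro x
        have h := congrArg (eval x) hc
        rw [eval_substPoly, smul_eval] at h
        rw [← h]
        congr 2
        funext i
        fin_cases i <;>
          simp [Matrix.mulVec, dotProduct, Fin.sum_univ_three, z01, z02, z10, z12, z20, z21]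
      obtain ⟨f1, f2⟩ := aut_form β hβ m _ _ _ _ n0 n1 n2 hx
      obtain ⟨k, -, hk⟩ := hζ'.eq_pow_of_pow_eq_one f1
      refine ⟨(k : ℤ), ?_⟩
      have := mk_eq_iff_scalar (A ^ k) B (B 0 0) (by
        rw [pow_val ζ A hA, hk]
        ext i j
        fin_cases i <;> fin_cases j <;> simp [z01, z02, z10, z12, z20, z21]
        · field_simp
        · exact f2)
      simpa using this
    · rw [Subgroup.zpowers_le]
      exact ⟨A, gen_mem β m ζ hζ'.pow_eq_one A hA, rfl⟩
  refine ⟨main, ?_⟩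
  rw [main, Nat.card_zpowers]
  change _ = m + 4
  rw [hζ'.eq_orderOf]
  apply orderOf_eq_orderOf_iff.2
  intro k
  rw [← map_pow, QuotientGroup.mk'_apply, QuotientGroup.eq_one_iff,
    Matrix.GeneralLinearGroup.mem_center_iff_val_mem_range_scalar, pow_val ζ A hA]
  constructor
  · rintro ⟨a, ha⟩
    have h0 := congrFun (congrFun ha 0) 0
    have h1 := congrFun (congrFun ha 1) 1
    simp [Matrix.scalar_apply] at h0 h1
    rw [← h1, h0]
  · intro h
    refine ⟨1, ?_⟩
    rw [h]
    ext i j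
    fin_cases i <;> fin_cases j <;> simp [Matrix.scalar_apply]

end
end

section
/- Let K be an algebraically closed field of characteristic 0 and let δ ∈ K satisfy δ ∉ Υ, where Υ = {−3} ∪ {roots in K of g₁(v)·g₂(v)·g₃(v)} with g₁(v) = v·(v²+v+7)·(v(v+7)+49)·(v⁴−39v²+441), g₂(v) = (v·(v·(v+2)·(v²+v+4)+3)−3)+1, and g₃(v) = 19+(v−3)·v·(7+(v−4)v)·(3+(v−2)v). Assume F = X⁵·Y + Y⁵·Z + Z⁵·X + δ·X²·Y·Z³ is nonsingular. Then Aut(F) is the cyclic group of order 3 generated by the class of diag(1, ω, ω²), where ω ∈ K is a primitive third root of unity. -/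
open MvPolynomial Matrix

noncomputable section

variable {K : Type*} [Field K]

/-- `g₁(v) = v(v²+v+7)(v(v+7)+49)(v⁴−39v²+441)`. -/
def gOne {K : Type*} [Field K] (v : K) : K :=
  v * (v ^ 2 + v + 7) * (v * (v + 7) + 49) * (v ^ 4 - 39 * v ^ 2 + 441)

/-- `g₂(v) = (v(v(v+2)(v²+v+4)+3)−3)+1`. -/
def gTwo {K : Type*} [Field K] (v : K) : K :=
  (v * (v * (v + 2) * (v ^ 2 + v + 4) + 3) - 3) + 1

/-- `g₃(v) = 19+(v−3)v(7+(v−4)v)(3+(v−2)v)`. -/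
def gThree {K : Type*} [Field K] (v : K) : K :=
  19 + (v - 3) * v * (7 + (v - 4) * v) * (3 + (v - 2) * v)

/-- `Υ = {−3} ∪ {roots of g₁·g₂·g₃}`. -/
def Upsilon (K : Type*) [Field K] : Set K :=
  {-3} ∪ {v : K | gOne v * gTwo v * gThree v = 0}


/-- The sextic as a function. -/
def Fe (δ x y z : K) : K := x ^ 5 * y + y ^ 5 * z + z ^ 5 * x + δ * x ^ 2 * y * z ^ 3

lemma coef_zero [CharZero K] (c0 c1 c2 c3 c4 c5 c6 : K)
    (h : ∀ x : K, c0 + c1 * x + c2 * x ^ 2 + c3 * x ^ 3 + c4 * x ^ 4 + c5 * x ^ 5 + c6 * x ^ 6 = 0) :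
    c0 = 0 ∧ c1 = 0 ∧ c2 = 0 ∧ c3 = 0 ∧ c4 = 0 ∧ c5 = 0 ∧ c6 = 0 := by
  have hp : (Polynomial.C c0 + Polynomial.C c1 * Polynomial.X + Polynomial.C c2 * Polynomial.X ^ 2
      + Polynomial.C c3 * Polynomial.X ^ 3 + Polynomial.C c4 * Polynomial.X ^ 4
      + Polynomial.C c5 * Polynomial.X ^ 5 + Polynomial.C c6 * Polynomial.X ^ 6 : Polynomial K)
      = 0 := by
    apply Polynomial.funext
    intro x
    simpa using h x
  have hc : ∀ n, (Polynomial.C c0 + Polynomial.C c1 * Polynomial.X + Polynomial.C c2 * Polynomial.X ^ 2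
      + Polynomial.C c3 * Polynomial.X ^ 3 + Polynomial.C c4 * Polynomial.X ^ 4
      + Polynomial.C c5 * Polynomial.X ^ 5 + Polynomial.C c6 * Polynomial.X ^ 6 : Polynomial K).coeff n
      = 0 := by
    intro n; rw [hp]; simp
  refine ⟨?_, ?_, ?_, ?_, ?_, ?_, ?_⟩
  · simpa [Polynomial.coeff_X, Polynomial.coeff_C] using hc 0
  · simpa [Polynomial.coeff_X, Polynomial.coeff_C] using hc 1
  · simpa [Polynomial.coeff_X, Polynomial.coeff_C] using hc 2
  · simpa [Polynomial.coeff_X, Polynomial.coeff_C] using hc 3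
  · simpa [Polynomial.coeff_X, Polynomial.coeff_C] using hc 4
  · simpa [Polynomial.coeff_X, Polynomial.coeff_C] using hc 5
  · simpa [Polynomial.coeff_X, Polynomial.coeff_C] using hc 6

lemma sigma_zero [CharZero K] (σ μ e A : K)
    (h4 : 10 * μ ^ 2 + 3 * e * μ = 10 + 5 * σ)
    (h3 : 10 * μ ^ 3 + 3 * e * μ ^ 2 = 10 + 10 * σ)
    (h2 : 5 * μ ^ 4 + e * μ ^ 3 = 5 + 10 * σ)
    (h1 : A * μ ^ 5 + 1 = A * (1 + 5 * σ))
    (h0 : μ = A * σ) : σ = 0 := by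
  have hμ : μ * (2 + σ) = 2 * (1 + σ) := by
    have h5 : (5 : K) ≠ 0 := by norm_num
    apply mul_left_cancel₀ h5
    linear_combination h3 - μ * h4
  have e1 : μ ^ 4 + μ ^ 2 * (2 + σ) - 3 - 6 * σ = 0 := by
    have h5 : (5 : K) ≠ 0 := by norm_num
    apply mul_left_cancel₀ h5
    linear_combination 3 * h2 - μ ^ 2 * h4
  have e2 : μ * (μ ^ 5 - 1 - 5 * σ) + σ = 0 := by
    linear_combination (μ ^ 5 - 1 - 5 * σ) * h0 + σ * h1
  have P1 : 16*(1+σ)^4+4*(1+σ)^2*(2+σ)^3-(3+6*σ)*(2+σ)^4 = 0 := by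
    have a4 : (μ * (2 + σ)) ^ 4 = (2 * (1 + σ)) ^ 4 := by rw [hμ]
    have a2 : (μ * (2 + σ)) ^ 2 = (2 * (1 + σ)) ^ 2 := by rw [hμ]
    linear_combination (2 + σ) ^ 4 * e1 - a4 - (2 + σ) ^ 3 * a2
  have P2 : 64*(1+σ)^6-2*(1+σ)*(1+5*σ)*(2+σ)^5+σ*(2+σ)^6 = 0 := by
    have a6 : (μ * (2 + σ)) ^ 6 = (2 * (1 + σ)) ^ 6 := by rw [hμ]
    linear_combination (2 + σ) ^ 6 * e2 - a6 + (1 + 5 * σ) * (2 + σ) ^ 5 * hμ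
  have hb : (-744472066304 : K) * σ = 0 := by
    linear_combination
      ((-6932399361184) + (-17814507841040)*σ^1 + (-14718391583088)*σ^2 + (-5695310658480)*σ^3 + (-2798724836448)*σ^4 + (-1247727566196)*σ^5) * P1
      + ((1163154810888) + (635020101040)*σ^1 + (-71243128676)*σ^2 + (277272792488)*σ^3) * P2
  exact (mul_eq_zero.mp hb).resolve_left (by norm_num)

lemma lineZ [CharZero K] (δ a b p q r s : K)
    (h : ∀ x y, Fe δ x y (a * x + b * y) = (p * x + q * y) ^ 5 * (r * x + s * y)) :
    a = 0 ∧ b = 0 := by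
  obtain ⟨c0, c1, c2, c3, c4, c5, c6⟩ := coef_zero
    (b - q ^ 5 * s) (b ^ 5 + a - (5 * q ^ 4 * p * s + q ^ 5 * r))
    (5 * a * b ^ 4 + δ * b ^ 3 - (10 * q ^ 3 * p ^ 2 * s + 5 * q ^ 4 * p * r))
    (10 * a ^ 2 * b ^ 3 + 3 * δ * a * b ^ 2 - (10 * q ^ 2 * p ^ 3 * s + 10 * q ^ 3 * p ^ 2 * r))
    (10 * a ^ 3 * b ^ 2 + 3 * δ * a ^ 2 * b - (5 * q * p ^ 4 * s + 10 * q ^ 2 * p ^ 3 * r))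
    (1 + 5 * a ^ 4 * b + δ * a ^ 3 - (p ^ 5 * s + 5 * q * p ^ 4 * r))
    (a ^ 5 - p ^ 5 * r)
    (fun x => by have := h x 1; unfold Fe at this; linear_combination this)
  have n5 : (5 : K) ≠ 0 := by norm_num
  have n10 : (10 : K) ≠ 0 := by norm_num
  by_cases hb : b = 0
  · subst hb
    refine ⟨?_, rfl⟩
    by_contra ha
    have hpr : p ^ 5 * r ≠ 0 := fun h0 => ha (by
      have : a ^ 5 = 0 := by linear_combination c6 + h0
      simpa using this)
    have hp : p ≠ 0 := by rintro rfl; simp at hpr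
    have hr : r ≠ 0 := by rintro rfl; simp at hpr
    have hq : q ≠ 0 := by
      rintro rfl; apply ha; linear_combination c1
    have hs : s = 0 := by
      have : q ^ 5 * s = 0 := by linear_combination -c0
      simpa [hq] using this
    subst hs
    have : 5 * q ^ 4 * p * r = 0 := by linear_combination -c2
    simp [hq, hp, hr] at this
  by_cases ha : a = 0
  · subst ha
    exfalso
    have hqs : q ^ 5 * s ≠ 0 := fun h0 => hb (by linear_combination c0 + h0)
    have hq : q ≠ 0 := by rintro rfl; simp at hqs
    have hs : s ≠ 0 := by rintro rfl; simp at hqs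
    have hp : p ≠ 0 := by
      rintro rfl; apply one_ne_zero (α := K); linear_combination c5
    have hr : r = 0 := by
      have : p ^ 5 * r = 0 := by linear_combination -c6
      simpa [hp] using this
    subst hr
    have : 5 * q * p ^ 4 * s = 0 := by linear_combination -c4
    simp [hq, hp, hs] at this
  exfalso
  have hpr : p ^ 5 * r ≠ 0 := fun h0 => ha (by
      have : a ^ 5 = 0 := by linear_combination c6 + h0
      simpa using this)
  have hp : p ≠ 0 := by rintro rfl; simp at hpr
  have hr : r ≠ 0 := by rintro rfl; simp at hpr
  have hqs : q ^ 5 * s ≠ 0 := fun h0 => hb (by linear_combination c0 + h0)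
  have hq : q ≠ 0 := by rintro rfl; simp at hqs
  have hs : s ≠ 0 := by rintro rfl; simp at hqs
  obtain ⟨t, rfl⟩ : ∃ t, q = t * p := ⟨q / p, by field_simp⟩
  have ht : t ≠ 0 := by rintro rfl; simp at hq
  obtain ⟨σ, rfl⟩ : ∃ σ, s = σ * (t * r) := ⟨s / (t * r), by field_simp⟩
  have hσ : σ ≠ 0 := by rintro rfl; simp at hs
  obtain ⟨μ, rfl⟩ : ∃ μ, b = μ * (a * t) := ⟨b / (a * t), by field_simp⟩
  obtain ⟨e, rfl⟩ : ∃ e, δ = e * (a ^ 2 * t) := ⟨δ / (a ^ 2 * t), by field_simp⟩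
  apply hσ
  apply sigma_zero σ μ e (a ^ 4 * t ^ 5)
  · apply mul_left_cancel₀ (mul_ne_zero (pow_ne_zero 5 ha) (pow_ne_zero 2 ht))
    linear_combination c4 - t ^ 2 * (10 + 5 * σ) * c6
  · apply mul_left_cancel₀ (mul_ne_zero (pow_ne_zero 5 ha) (pow_ne_zero 3 ht))
    linear_combination c3 - t ^ 3 * (10 + 10 * σ) * c6
  · apply mul_left_cancel₀ (mul_ne_zero (pow_ne_zero 5 ha) (pow_ne_zero 4 ht))
    linear_combination c2 - t ^ 4 * (5 + 10 * σ) * c6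
  · apply mul_left_cancel₀ ha
    linear_combination c1 - t ^ 5 * (1 + 5 * σ) * c6
  · apply mul_left_cancel₀ (mul_ne_zero ha ht)
    linear_combination c0 - t ^ 6 * σ * c6

lemma lineY [CharZero K] (δ a p q r s : K)
    (h : ∀ x z, Fe δ x (a * x) z = (p * x + q * z) ^ 5 * (r * x + s * z)) :
    a = 0 := by
  obtain ⟨c0, c1, c2, c3, c4, c5, c6⟩ := coef_zero
    (- q ^ 5 * s) (1 - (5 * q ^ 4 * p * s + q ^ 5 * r))
    (- (10 * q ^ 3 * p ^ 2 * s + 5 * q ^ 4 * p * r))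
    (δ * a - (10 * q ^ 2 * p ^ 3 * s + 10 * q ^ 3 * p ^ 2 * r))
    (- (5 * q * p ^ 4 * s + 10 * q ^ 2 * p ^ 3 * r))
    (a ^ 5 - (p ^ 5 * s + 5 * q * p ^ 4 * r))
    (a - p ^ 5 * r)
    (fun x => by have := h x 1; unfold Fe at this; linear_combination this)
  have hq : q ≠ 0 := by
    rintro rfl; apply one_ne_zero (α := K); linear_combination c1
  have hs : s = 0 := by simpa [hq] using c0
  subst hs
  have hr : r ≠ 0 := by
    rintro rfl; apply one_ne_zero (α := K); linear_combination c1
  have hp : p = 0 := by simpa [hq, hr] using c2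
  subst hp
  linear_combination c6

lemma plane [CharZero K] (δ l u0 u1 u2 w0 w1 w2 : K)
    (hne : u1 * w2 - u2 * w1 ≠ 0 ∨ u0 * w2 - u2 * w0 ≠ 0 ∨ u0 * w1 - u1 * w0 ≠ 0)
    (h : ∀ x z, Fe δ (x * u0 + z * w0) (x * u1 + z * w1) (x * u2 + z * w2) = l * (x * z ^ 5)) :
    (u0 = 0 ∧ w0 = 0) ∨ (u1 = 0 ∧ w1 = 0) ∨ (u2 = 0 ∧ w2 = 0) := by
  by_cases m2 : u0 * w1 - u1 * w0 = 0
  · by_cases m1 : u0 * w2 - u2 * w0 = 0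
    · have m0 : u1 * w2 - u2 * w1 ≠ 0 := by tauto
      left
      constructor
      · apply mul_left_cancel₀ m0
        linear_combination u1 * m1 - u2 * m2
      · apply mul_left_cancel₀ m0
        linear_combination w1 * m1 - w2 * m2
    · right; left
      obtain ⟨d, hd⟩ : ∃ d, (u0 * w2 - u2 * w0) * d = 1 := ⟨_, mul_inv_cancel₀ m1⟩
      have d0 : d ≠ 0 := right_ne_zero_of_mul_eq_one hd
      have key := lineY δ ((u1 * w2 - u2 * w1) * d)
        (-u2 * d) (u0 * d)
        (l * (w2 * d)) (l * (-w0 * d))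
        (fun x z => by
          have := h ((x * w2 - z * w0) * d) ((u0 * z - u2 * x) * d)
          have f0 : (x * w2 - z * w0) * d * u0
            + (u0 * z - u2 * x) * d * w0 = x := by
            linear_combination x * hd
          have f2 : (x * w2 - z * w0) * d * u2
            + (u0 * z - u2 * x) * d * w2 = z := by
            linear_combination z * hd
          have f1 : (x * w2 - z * w0) * d * u1
            + (u0 * z - u2 * x) * d * w1
              = (u1 * w2 - u2 * w1) * d * x := by
            linear_combination z * d * m2
          rw [f0, f1, f2] at this
          rw [this]; ring)
      have m0 : u1 * w2 - u2 * w1 = 0 := by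
        simpa [d0] using key
      constructor
      · apply mul_left_cancel₀ m1
        linear_combination u0 * m0 + u2 * m2
      · apply mul_left_cancel₀ m1
        linear_combination w0 * m0 + w2 * m2
  · right; right
    obtain ⟨d, hd⟩ : ∃ d, (u0 * w1 - u1 * w0) * d = 1 := ⟨_, mul_inv_cancel₀ m2⟩
    have d0 : d ≠ 0 := right_ne_zero_of_mul_eq_one hd
    have key := lineZ δ ((u2 * w1 - u1 * w2) * d)
        ((u0 * w2 - u2 * w0) * d)
        (-u1 * d) (u0 * d)
        (l * (w1 * d)) (l * (-w0 * d))
        (fun x y => by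
          have := h ((x * w1 - y * w0) * d) ((u0 * y - u1 * x) * d)
          have f0 : (x * w1 - y * w0) * d * u0
            + (u0 * y - u1 * x) * d * w0 = x := by
            linear_combination x * hd
          have f1 : (x * w1 - y * w0) * d * u1
            + (u0 * y - u1 * x) * d * w1 = y := by
            linear_combination y * hd
          have f2 : (x * w1 - y * w0) * d * u2
            + (u0 * y - u1 * x) * d * w2
              = (u2 * w1 - u1 * w2) * d * x
                + (u0 * w2 - u2 * w0) * d * y := by
            ring
          rw [f0, f1, f2] at this
          rw [this]; ring)
    obtain ⟨k0, k1⟩ := key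
    have m0 : u2 * w1 - u1 * w2 = 0 := by simpa [d0] using k0
    have m1 : u0 * w2 - u2 * w0 = 0 := by simpa [d0] using k1
    constructor
    · apply mul_left_cancel₀ m2
      linear_combination u0 * m0 + u1 * m1
    · apply mul_left_cancel₀ m2
      linear_combination w0 * m0 + w1 * m1

lemma main_aux [CharZero K] (δ l a0 a1 a2 b0 b1 b2 c0 c1 c2 : K) (hδ : δ ≠ 0) (hl : l ≠ 0)
    (hdet : a0 * (b1 * c2 - b2 * c1) - a1 * (b0 * c2 - b2 * c0) + a2 * (b0 * c1 - b1 * c0) ≠ 0)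
    (h : ∀ x y z, Fe δ (x * a0 + y * b0 + z * c0) (x * a1 + y * b1 + z * c1)
      (x * a2 + y * b2 + z * c2) = l * Fe δ x y z) :
    a1 = 0 ∧ a2 = 0 ∧ b0 = 0 ∧ b2 = 0 ∧ c0 = 0 ∧ c1 = 0 := by
  have p1 := plane δ l a0 a1 a2 c0 c1 c2
    (by
      by_contra hh
      push Not at hh
      obtain ⟨h1, h2, h3⟩ := hh
      apply hdet
      linear_combination -b0 * h1 + b1 * h2 - b2 * h3)
    (fun x z => by have := h x 0 z; unfold Fe at this ⊢; linear_combination this)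
  have p2 := plane δ l c0 c1 c2 b0 b1 b2
    (by
      by_contra hh
      push Not at hh
      obtain ⟨h1, h2, h3⟩ := hh
      apply hdet
      linear_combination -a0 * h1 + a1 * h2 - a2 * h3)
    (fun x z => by have := h 0 z x; unfold Fe at this ⊢; linear_combination this)
  have p3 := plane δ l b0 b1 b2 a0 a1 a2
    (by
      by_contra hh
      push Not at hh
      obtain ⟨h1, h2, h3⟩ := hh
      apply hdet
      linear_combination -c0 * h1 + c1 * h2 - c2 * h3)
    (fun x z => by have := h z x 0; unfold Fe at this ⊢; linear_combination this)
  have hld : l * δ ≠ 0 := mul_ne_zero hl hδ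
  have n2 : (2 : K) ≠ 0 := by norm_num
  rcases p1 with ⟨rfl, rfl⟩ | ⟨rfl, rfl⟩ | ⟨rfl, rfl⟩ <;>
  rcases p2 with ⟨g1, g2⟩ | ⟨g1, g2⟩ | ⟨g1, g2⟩ <;>
  rcases p3 with ⟨g3, g4⟩ | ⟨g3, g4⟩ | ⟨g3, g4⟩ <;>
  first
  | (exfalso; apply hdet; simp [g1, g2, g3, g4]; done)
  | (simp [g1, g2, g3, g4]; done)
  | skip
  · subst g1 g2 g3 g4
    exfalso
    have k := coef_zero (c2 ^ 5 * b0 - l) (b0 ^ 5 * a1 + δ * b0 ^ 2 * a1 * c2 ^ 3 - l) (- (l * δ))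
      0 0 (a1 ^ 5 * c2 - l) 0
      (fun x => by have := h x 1 1; unfold Fe at this; linear_combination this)
    exact hld (neg_eq_zero.mp k.2.2.1)
  · subst g1 g2 g3 g4
    exfalso
    have k := coef_zero (b0 ^ 5 * c1 - l) (c1 ^ 5 * a2 - l) (- (l * δ))
      (δ * b0 ^ 2 * c1 * a2 ^ 3) 0 (a2 ^ 5 * b0 - l) 0
      (fun x => by have := h x 1 1; unfold Fe at this; linear_combination this)
    exact hld (neg_eq_zero.mp k.2.2.1)
  · subst g1 g2 g3 g4
    exfalso
    have k := coef_zero (c0 ^ 5 * b1 - l) (b1 ^ 5 * a2 - l) (- (l * δ))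
      (δ * c0 ^ 2 * b1 * a2 ^ 3) 0 (a2 ^ 5 * c0 - l) 0
      (fun x => by have := h x 1 1; unfold Fe at this; linear_combination this)
    exact hld (neg_eq_zero.mp k.2.2.1)
  · subst g1 g2 g3 g4
    exfalso
    have k := coef_zero (c1 ^ 5 * b2 - l) (b2 ^ 5 * a0 - l) (δ * a0 ^ 2 * c1 * b2 ^ 3 - l * δ)
      0 0 (a0 ^ 5 * c1 - l) 0
      (fun x => by have := h x 1 1; unfold Fe at this; linear_combination this)
    have k' := coef_zero (2 * c1 ^ 5 * b2 - 32 * l) (32 * b2 ^ 5 * a0 - l)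
      (8 * δ * a0 ^ 2 * c1 * b2 ^ 3 - 2 * l * δ)
      0 0 (a0 ^ 5 * c1 - 2 * l) 0
      (fun x => by have := h x 2 1; unfold Fe at this; linear_combination this)
    have n6 : (6 : K) ≠ 0 := by norm_num
    apply hld
    apply mul_left_cancel₀ n6
    linear_combination k'.2.2.1 - 8 * k.2.2.1
  · subst g1 g2 g3 g4
    exfalso
    have k := coef_zero (b2 ^ 5 * c0 - l) (c0 ^ 5 * a1 + δ * c0 ^ 2 * a1 * b2 ^ 3 - l) (- (l * δ))
      0 0 (a1 ^ 5 * b2 - l) 0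
      (fun x => by have := h x 1 1; unfold Fe at this; linear_combination this)
    exact hld (neg_eq_zero.mp k.2.2.1)

lemma main_diag [CharZero K] (δ l a b c : K) (hδ : δ ≠ 0) (hl : l ≠ 0)
    (h : ∀ x y z, Fe δ (x * a) (y * b) (z * c) = l * Fe δ x y z) :
    a ≠ 0 ∧ ∃ ζ : K, ζ ^ 3 = 1 ∧ c = a * ζ ∧ b = a * ζ ^ 2 := by
  have e1 : a ^ 5 * b = l := by
    have := h 1 1 0; unfold Fe at this; linear_combination this
  have e2 : b ^ 5 * c = l := by
    have := h 0 1 1; unfold Fe at this; linear_combination this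
  have e3 : c ^ 5 * a = l := by
    have := h 1 0 1; unfold Fe at this; linear_combination this
  have e4 : a ^ 2 * b * c ^ 3 = l := by
    have := h 1 1 1
    apply mul_left_cancel₀ hδ
    unfold Fe at this; linear_combination this - e1 - e2 - e3
  have ha : a ≠ 0 := by
    rintro rfl; apply hl; linear_combination -e1
  have hb : b ≠ 0 := by
    rintro rfl; apply hl; linear_combination -e1
  refine ⟨ha, ?_⟩
  obtain ⟨ζ, rfl⟩ : ∃ ζ, c = a * ζ := ⟨c / a, by field_simp⟩
  have hζ : ζ ^ 3 = 1 := by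
    apply mul_left_cancel₀ (mul_ne_zero (pow_ne_zero 5 ha) hb)
    linear_combination e4 - e1
  refine ⟨ζ, hζ, rfl, ?_⟩
  apply mul_left_cancel₀ (pow_ne_zero 5 ha)
  linear_combination e1 - e3 + a ^ 6 * ζ ^ 2 * hζ

lemma eval_substPoly_s17 (M : Matrix (Fin 3) (Fin 3) K) (F : MvPolynomial (Fin 3) K) (v : Fin 3 → K) :
    eval v (substPoly M F) = eval (fun i => ∑ j, M i j * v j) F := by
  have h : (eval v).comp (aeval (R := K) (fun i => ∑ j, M i j • (X j : MvPolynomial (Fin 3) K))).toRingHom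
      = eval (fun i => ∑ j, M i j * v j) := by
    apply MvPolynomial.ringHom_ext
    · intro r; simp
    · intro i; simp [smul_eval]
  exact congrArg (fun f => f F) h

/-- for `δ ∉ Υ` with `F = X⁵Y + Y⁵Z + Z⁵X + δ·X²YZ³` nonsingular,
`Aut(F)` is the cyclic group of order 3 generated by the class of `diag(1, ω, ω²)`. -/
theorem stmt17 {K : Type*} [Field K] [IsAlgClosed K] [CharZero K]
    (δ : K) (hδ : δ ∉ Upsilon K)
    (F : MvPolynomial (Fin 3) K)
    (hF : F = X 0 ^ 5 * X 1 + X 1 ^ 5 * X 2 + X 2 ^ 5 * X 0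
        + C δ * X 0 ^ 2 * X 1 * X 2 ^ 3)
    (hns : IsNonsingular F)
    (ω : K) (hω : IsPrimitiveRoot ω 3)
    (A : GL (Fin 3) K)
    (hA : (A : Matrix (Fin 3) (Fin 3) K) = Matrix.diagonal ![1, ω, ω ^ 2]) :
    projAut F
      = Subgroup.zpowers (QuotientGroup.mk' (Subgroup.center (GL (Fin 3) K)) A) ∧
    Nat.card ↥(projAut F) = 3 := by
  have hδ0 : δ ≠ 0 := by
    rintro rfl
    apply hδ
    right
    simp [gOne]
  have hFe : ∀ v : Fin 3 → K, eval v F = Fe δ (v 0) (v 1) (v 2) := by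
    intro v; subst hF; simp [Fe]
  have hω3 : ω ^ 3 = 1 := hω.pow_eq_one
  have hω0 : ω ≠ 0 := hω.ne_zero (by norm_num)
  have hA3 : A ^ 3 = 1 := by
    apply Units.ext
    rw [Units.val_pow_eq_pow_val, hA, Matrix.diagonal_pow, Units.val_one, ← Matrix.diagonal_one]
    congr 1
    funext i
    fin_cases i
    · simp
    · simpa using hω3
    · have : (ω ^ 2) ^ 3 = 1 := by rw [← pow_mul, mul_comm, pow_mul, hω3, one_pow]
      simpa using this
  have hmemA : A ∈ autGL F := by
    refine ⟨Units.mk0 ω hω0, ?_⟩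
    apply MvPolynomial.funext
    intro v
    rw [eval_substPoly_s17, hFe, smul_eval, hFe, hA]
    simp [Matrix.diagonal_apply, Fin.sum_univ_three, Fe]
    linear_combination (v 1 ^ 5 * v 2 * (ω ^ 4 + ω) + v 2 ^ 5 * v 0 * (ω ^ 7 + ω ^ 4 + ω)
      + δ * v 0 ^ 2 * v 1 * v 2 ^ 3 * (ω ^ 4 + ω)) * hω3
  have hmain : projAut F
      = Subgroup.zpowers (QuotientGroup.mk' (Subgroup.center (GL (Fin 3) K)) A) := by
    apply le_antisymm
    · rintro _ ⟨B, ⟨c, hc⟩, rfl⟩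
      have hB : ∀ x y z, Fe δ (x * B 0 0 + y * B 0 1 + z * B 0 2)
          (x * B 1 0 + y * B 1 1 + z * B 1 2)
          (x * B 2 0 + y * B 2 1 + z * B 2 2) = c * Fe δ x y z := by
        intro x y z
        have h1 := congrArg (eval ![x, y, z]) hc
        rw [eval_substPoly_s17, hFe, smul_eval, hFe] at h1
        simp only [Fin.sum_univ_three] at h1
        simp at h1
        rw [← h1]
        congr 1 <;> ring
      have hdet : (B : Matrix (Fin 3) (Fin 3) K).det ≠ 0 :=
        ((Matrix.isUnit_iff_isUnit_det _).mp B.isUnit).ne_zero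
      rw [Matrix.det_fin_three] at hdet
      obtain ⟨h1, h2, h3, h4, h5, h6⟩ := main_aux δ c _ _ _ _ _ _ _ _ _ hδ0 c.ne_zero
        (fun h0 => hdet (by linear_combination h0)) hB
      obtain ⟨ha, ζ, hζ, hz, hy⟩ := main_diag δ c (B 0 0) (B 1 1) (B 2 2) hδ0 c.ne_zero
        (fun x y z => by have := hB x y z; rw [h1, h2, h3, h4, h5, h6] at this; simpa using this)
      obtain ⟨i, hi, rfl⟩ := hω.eq_pow_of_pow_eq_one hζ
      have hcomm : (A ^ (2 * i))⁻¹ * B ∈ Subgroup.center (GL (Fin 3) K) := by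
        have hBe : B = A ^ (2 * i) * Matrix.GeneralLinearGroup.scalar (Fin 3) (Units.mk0 _ ha) := by
          apply Units.ext
          rw [Units.val_mul, Units.val_pow_eq_pow_val, hA, Matrix.diagonal_pow]
          have e4 : ω ^ (2 * (i * 2)) = ω ^ i := by
            rw [show 2 * (i * 2) = 3 * i + i by ring, pow_add, pow_mul, hω3]; simp
          ext p q
          rw [Matrix.diagonal_mul]
          fin_cases p <;> fin_cases q <;>
            simp [h1, h2, h3, h4, h5, h6, hz, hy, ← pow_mul, e4, mul_comm]
        rw [hBe, inv_mul_cancel_left]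
        rw [Subgroup.mem_center_iff]
        intro g
        apply Units.ext
        rw [Units.val_mul, Units.val_mul]
        ext p q
        simp [mul_comm]
      refine ⟨(2 * i : ℕ), ?_⟩
      have := QuotientGroup.eq.mpr hcomm
      rw [QuotientGroup.mk_pow] at this
      exact (zpow_natCast _ _).trans this
    · rw [Subgroup.zpowers_le]
      exact ⟨A, hmemA, rfl⟩
  refine ⟨hmain, ?_⟩
  rw [hmain, Nat.card_zpowers]
  have : Fact (Nat.Prime 3) := ⟨Nat.prime_three⟩
  apply orderOf_eq_prime
  · rw [← map_pow, hA3, map_one]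
  · intro h1
    have h2 : A ∈ Subgroup.center (GL (Fin 3) K) := (QuotientGroup.eq_one_iff A).mp h1
    rw [Subgroup.mem_center_iff] at h2
    have hdS : (!![1, 1, 0; 0, 1, 0; 0, 0, 1] : Matrix (Fin 3) (Fin 3) K).det ≠ 0 := by
      simp [Matrix.det_fin_three]
    have h3 := congrArg (fun g : GL (Fin 3) K => (g : Matrix (Fin 3) (Fin 3) K) 0 1)
      (h2 (Matrix.GeneralLinearGroup.mkOfDetNeZero _ hdS))
    simp [hA, Matrix.GeneralLinearGroup.mkOfDetNeZero, Matrix.mul_apply, Fin.sum_univ_three,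
      Matrix.diagonal_apply] at h3
    exact hω.ne_one (by norm_num) h3

end
end
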